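/- arXiv:1312.7426 — 3 statements merged into one kernel-verified Lean document; each statement's English description precedes it below -/
import Mathlib

section
/- Let D be a dendrite and f : D → D a continuous transitive map. If there exists a point q ∈ D \ End(D) whose orbit under f is dense in D, then (D,f) admits a terminal regular periodic decomposition. -/
open Set Topology Filter TopologicalSpace

/-- A dendrite: a nondegenerate continuum in which any two distinct points can be
separated by a third point. -/
def IsDendrite (X : Type*) [TopologicalSpace X] : Prop :=
  Nontrivial X ∧ ∀ x y : X, x ≠ y → ∃ z : X, z ≠ x ∧ z ≠ y ∧
    connectedComponentIn ({z}ᶜ : Set X) x ≠ connectedComponentIn ({z}ᶜ : Set X) y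

/-- `p` is an endpoint of `X` if `X \ {p}` is connected. -/
def IsEndpointOf (X : Type*) [TopologicalSpace X] (p : X) : Prop :=
  IsPreconnected ({p}ᶜ : Set X)

/-- A periodic point of `f`. -/
def IsPeriodic {X : Type*} (f : X → X) (x : X) : Prop :=
  ∃ n : ℕ, 1 ≤ n ∧ f^[n] x = x

/-- `x` has dense forward orbit under `f`. -/
def HasDenseOrbit {X : Type*} [TopologicalSpace X] (f : X → X) (x : X) : Prop :=
  Dense {y : X | ∃ n : ℕ, 1 ≤ n ∧ f^[n] x = y}

/-- Topological transitivity. -/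
def TopTransitive {X : Type*} [TopologicalSpace X] (f : X → X) : Prop :=
  ∀ U V : Set X, IsOpen U → IsOpen V → U.Nonempty → V.Nonempty →
    ∃ n : ℕ, 0 < n ∧ (f^[n] '' U ∩ V).Nonempty

/-- Total transitivity: every iterate is transitive. -/
def TotallyTransitive {X : Type*} [TopologicalSpace X] (f : X → X) : Prop :=
  ∀ n : ℕ, 1 ≤ n → TopTransitive (f^[n])

/-- Weak mixing: `f × f` is transitive. -/
def WeaklyMixing {X : Type*} [TopologicalSpace X] (f : X → X) : Prop :=
  TopTransitive (Prod.map f f)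

/-- Topological mixing. -/
def TopMixing {X : Type*} [TopologicalSpace X] (f : X → X) : Prop :=
  ∀ U V : Set X, IsOpen U → IsOpen V → U.Nonempty → V.Nonempty →
    ∃ N : ℕ, ∀ n, N ≤ n → (f^[n] '' U ∩ V).Nonempty

/-- Exactness. -/
def TopExact {X : Type*} [TopologicalSpace X] (f : X → X) : Prop :=
  ∀ U : Set X, IsOpen U → U.Nonempty → ∃ N : ℕ, 0 < N ∧ f^[N] '' U = Set.univ

/-- `A` is an arc with endpoints `a` and `b`. -/
def IsArcEnds {X : Type*} [TopologicalSpace X] (A : Set X) (a b : X) : Prop :=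
  ∃ e : (Set.Icc (0:ℝ) 1) ≃ₜ A,
    (e ⟨0, by norm_num⟩ : X) = a ∧ (e ⟨1, by norm_num⟩ : X) = b

/-- `A` is a free arc with endpoints `a` and `b`. -/
def IsFreeArc {X : Type*} [TopologicalSpace X] (A : Set X) (a b : X) : Prop :=
  IsArcEnds A a b ∧ IsOpen (A \ {a, b})

/-- A regular periodic decomposition of length `m` for `f`. -/
def IsRegPerDecomp {X : Type*} [TopologicalSpace X] (f : X → X) (m : ℕ)
    (Ds : ZMod m → Set X) : Prop :=
  0 < m ∧ (∀ i, Ds i = closure (interior (Ds i))) ∧ (⋃ i, Ds i) = Set.univ ∧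
    (∀ i, f '' Ds i = Ds (i + 1)) ∧ (∀ i j, i ≠ j → IsNowhereDense (Ds i ∩ Ds j))

/-- `f` admits a terminal (maximal-length) regular periodic decomposition. -/
def HasTerminalDecomp {X : Type*} [TopologicalSpace X] (f : X → X) : Prop :=
  ∃ (m : ℕ) (Ds : ZMod m → Set X), IsRegPerDecomp f m Ds ∧
    ∀ (m' : ℕ) (Ds' : ZMod m' → Set X), IsRegPerDecomp f m' Ds' → m' ≤ m

/-- The induced map on the hyperspace of nonempty closed (= compact) subsets. -/
def hyperMap {X : Type*} [TopologicalSpace X] {f : X → X} (hf : Continuous f) :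
    NonemptyCompacts X → NonemptyCompacts X :=
  fun A => ⟨⟨f '' A, A.isCompact.image hf⟩, A.nonempty.image f⟩

/-- The set of connected components of `X \ {p}`. -/
def componentsAt (X : Type*) [TopologicalSpace X] (p : X) : Set (Set X) :=
  {C | ∃ x : X, x ≠ p ∧ C = connectedComponentIn ({p}ᶜ : Set X) x}

/-- The boundary bumping theorem: in a compact connected Hausdorff space, every component of a
proper closed subset meets the frontier of that subset. -/
theorem connectedComponentIn_inter_frontier_nonempty {X : Type*} [TopologicalSpace X]
    [CompactSpace X] [T2Space X] [PreconnectedSpace X] {F : Set X} (hF : IsClosed F)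
    (hne : F ≠ univ) {x : X} (hx : x ∈ F) :
    (connectedComponentIn F x ∩ frontier F).Nonempty := by
  by_contra h
  have : CompactSpace F := isCompact_iff_compactSpace.mp hF.isCompact
  have hint : connectedComponentIn F x ⊆ interior F := by
    intro y hy
    by_contra hyi
    exact h ⟨y, hy, subset_closure (connectedComponentIn_subset F x hy), hyi⟩
  let p : F := ⟨x, hx⟩
  have : Nonempty {s : Set F // IsClopen s ∧ p ∈ s} := ⟨⟨univ, isClopen_univ, mem_univ p⟩⟩
  obtain ⟨⟨s, hs, hps⟩, hsub⟩ := exists_subset_nhds_of_isCompact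
    (V := fun s : {s : Set F // IsClopen s ∧ p ∈ s} => s.1)
    (U := ((↑) : F → X) ⁻¹' interior F)
    (fun a b => ⟨⟨a.1 ∩ b.1, a.2.1.inter b.2.1, a.2.2, b.2.2⟩, inter_subset_left,
      inter_subset_right⟩)
    (fun a => a.2.1.isClosed.isCompact)
    (by
      rw [← connectedComponent_eq_iInter_isClopen]
      intro y hy
      refine (isOpen_interior.preimage continuous_subtype_val).mem_nhds (hint ?_)
      rw [connectedComponentIn_eq_image hx]
      exact mem_image_of_mem _ hy)
  have hcl : IsClopen (((↑) : F → X) '' s) := by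
    refine ⟨hF.isClosedEmbedding_subtypeVal.isClosedMap _ hs.isClosed, ?_⟩
    obtain ⟨V, hV, rfl⟩ := isOpen_induced_iff.mp hs.isOpen
    have : ((↑) : F → X) '' (((↑) : F → X) ⁻¹' V) = V ∩ interior F := by
      ext y
      constructor
      · rintro ⟨z, hz, rfl⟩
        exact ⟨hz, hsub hz⟩
      · rintro ⟨hyV, hyF⟩
        exact ⟨⟨y, interior_subset hyF⟩, hyV, rfl⟩
    rw [this]
    exact hV.inter isOpen_interior
  have huniv := hcl.eq_univ ⟨x, p, hps, rfl⟩
  refine hne (eq_univ_of_univ_subset ?_)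
  rw [← huniv]
  rintro _ ⟨y, -, rfl⟩
  exact y.2

/-- Components of a closed set are closed. -/
theorem IsClosed.isClosed_connectedComponentIn {X : Type*} [TopologicalSpace X] {F : Set X}
    (hF : IsClosed F) (x : X) : IsClosed (connectedComponentIn F x) := by
  by_cases hx : x ∈ F
  · rw [connectedComponentIn_eq_image hx]
    exact hF.isClosedEmbedding_subtypeVal.isClosedMap _ isClosed_connectedComponent
  · rw [connectedComponentIn_eq_empty hx]
    exact isClosed_empty

/-- Components are relatively closed. -/
theorem mem_connectedComponentIn_of_mem_closure {X : Type*} [TopologicalSpace X] {F : Set X}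
    {x y : X} (hy : y ∈ closure (connectedComponentIn F x)) (hyF : y ∈ F) :
    y ∈ connectedComponentIn F x := by
  by_cases hx : x ∈ F
  · refine (isPreconnected_connectedComponentIn.subset_closure (subset_insert y _)
      (insert_subset hy subset_closure)).subset_connectedComponentIn
      (mem_insert_of_mem _ (mem_connectedComponentIn hx))
      (insert_subset hyF (connectedComponentIn_subset F x)) (mem_insert y _)
  · simp [connectedComponentIn_eq_empty hx] at hy

/-- In a continuum, every component of the complement of a point accumulates at that point. -/
theorem mem_closure_connectedComponentIn_compl_singleton {X : Type*} [TopologicalSpace X]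
    [CompactSpace X] [T2Space X] [PreconnectedSpace X] {z w : X} (hw : w ≠ z) :
    z ∈ closure (connectedComponentIn {z}ᶜ w) := by
  by_contra hz
  have hsub : closure (connectedComponentIn {z}ᶜ w) ⊆ {z}ᶜ := fun y hy hyz => hz (hyz ▸ hy)
  obtain ⟨V, hV, hCV, hVz⟩ := normal_exists_closure_subset isClosed_closure
    isOpen_compl_singleton hsub
  have hwC : w ∈ connectedComponentIn {z}ᶜ w := mem_connectedComponentIn hw
  obtain ⟨y, hyC, hyF⟩ := connectedComponentIn_inter_frontier_nonempty
    (isClosed_closure (s := V)) (fun h => hVz (h ▸ mem_univ z) rfl)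
    (subset_closure (hCV (subset_closure hwC)))
  exact hyF.2 (interior_maximal subset_closure hV
    (hCV (subset_closure (connectedComponentIn_mono w hVz hyC))))

/-- A component of the complement of `z` that misses `z₁` lies, in the complement of `z₁`, in the
component of `z`. -/
theorem connectedComponentIn_compl_subset_of_notMem {X : Type*} [TopologicalSpace X]
    [CompactSpace X] [T2Space X] [PreconnectedSpace X] {z z₁ w : X} (hz : z₁ ≠ z)
    (hw : w ≠ z) (h : z₁ ∉ connectedComponentIn {z}ᶜ w) :
    connectedComponentIn {z}ᶜ w ⊆ connectedComponentIn {z₁}ᶜ z := by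
  refine (subset_insert z _).trans
    ((isPreconnected_connectedComponentIn.subset_closure (subset_insert z _)
      (insert_subset (mem_closure_connectedComponentIn_compl_singleton hw)
        subset_closure)).subset_connectedComponentIn (mem_insert z _) ?_)
  rintro y (rfl | hy) rfl
  · exact hz rfl
  · exact h hy

/-- Dendrites are connected im kleinen at every point. -/
theorem IsDendrite.connectedComponentIn_mem_nhds {D : Type*} [TopologicalSpace D]
    [CompactSpace D] [T2Space D] [PreconnectedSpace D] (hD : IsDendrite D) {F : Set D}
    (hF : IsClosed F) {x : D} (hxF : F ∈ 𝓝 x) : connectedComponentIn F x ∈ 𝓝 x := by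
  by_cases hne : F = univ
  · rw [hne, connectedComponentIn_univ, PreconnectedSpace.connectedComponent_eq_univ]
    exact univ_mem
  by_contra hnot
  have hfreq : ∃ᶠ w in 𝓝 x, w ∉ connectedComponentIn F x :=
    not_eventually.mp hnot
  have := frequently_iff_neBot.mp hfreq
  obtain ⟨u, hu⟩ := (𝓝 x ⊓ 𝓟 {w | w ∉ connectedComponentIn F x}).exists_ultrafilter_le
  have hux : (u : Filter D) ≤ 𝓝 x := hu.trans inf_le_left
  have huF : ∀ᶠ w in u, w ∈ F := hux hxF
  have huC : ∀ᶠ w in u, w ∉ connectedComponentIn F x := hu (mem_inf_of_right (mem_principal_self _))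
  have hg : ∀ w, ∃ v, w ∈ F → v ∈ connectedComponentIn F w ∩ frontier F := fun w => by
    by_cases hw : w ∈ F
    · obtain ⟨v, hv⟩ := connectedComponentIn_inter_frontier_nonempty hF hne hw
      exact ⟨v, fun _ => hv⟩
    · exact ⟨w, fun h => absurd h hw⟩
  choose g hg using hg
  obtain ⟨y, -, hy⟩ := isCompact_univ.ultrafilter_le_nhds (u.map g) (by simp)
  have hgy : Tendsto g u (𝓝 y) := hy
  have hyF : y ∈ frontier F :=
    isClosed_frontier.mem_of_tendsto hgy (huF.mono fun w hw => (hg w hw).2)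
  have hxy : x ≠ y := by
    rintro rfl
    exact hyF.2 (mem_interior_iff_mem_nhds.mpr hxF)
  obtain ⟨z, hzx, hzy, hz⟩ := hD.2 x y hxy
  obtain ⟨a, hax, haz, ha⟩ := hD.2 x z hzx.symm
  obtain ⟨b, hbz, hby, hb⟩ := hD.2 z y hzy
  have hzC : ∀ᶠ w in u, z ∉ connectedComponentIn F w := by
    by_contra hcon
    have hcon' : ∀ᶠ w in u, z ∈ connectedComponentIn F w := by
      simpa using Ultrafilter.eventually_not.not.mp hcon
    have hx : x ∈ connectedComponentIn F z := by
      refine (hF.isClosed_connectedComponentIn z).mem_of_tendsto (f := id) hux ?_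
      filter_upwards [hcon', huF] with w hw hwF
      rw [← connectedComponentIn_eq hw]
      exact mem_connectedComponentIn hwF
    obtain ⟨w, hw, hwF, hwC⟩ := (hcon'.and (huF.and huC)).exists
    refine hwC ?_
    rw [← connectedComponentIn_eq hx, ← connectedComponentIn_eq hw]
    exact mem_connectedComponentIn hwF
  have haC : a ∈ connectedComponentIn {z}ᶜ x := by
    by_contra h
    exact ha (connectedComponentIn_eq (connectedComponentIn_compl_subset_of_notMem haz hzx.symm h
      (mem_connectedComponentIn hzx.symm))).symm
  have hbC : b ∈ connectedComponentIn {z}ᶜ y := by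
    by_contra h
    exact hb (connectedComponentIn_eq (connectedComponentIn_compl_subset_of_notMem hbz hzy.symm h
      (mem_connectedComponentIn hzy.symm)))
  have hgz : ∀ᶠ w in u, w ≠ z ∧ w ∈ connectedComponentIn {z}ᶜ w ∧
      g w ∈ connectedComponentIn {z}ᶜ w := by
    filter_upwards [hzC, huF] with w hw hwF
    have hsub : connectedComponentIn F w ⊆ connectedComponentIn {z}ᶜ w :=
      isPreconnected_connectedComponentIn.subset_connectedComponentIn
        (mem_connectedComponentIn hwF) (fun v hv hvz => hw (hvz ▸ hv))
    have hwz : w ≠ z := fun h => hw (h ▸ mem_connectedComponentIn hwF)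
    exact ⟨hwz, mem_connectedComponentIn hwz, hsub (hg w hwF).1⟩
  by_cases hcase : ∀ᶠ w in u, a ∈ connectedComponentIn {z}ᶜ w
  · have hyb : y ∈ closure (connectedComponentIn {b}ᶜ z) := by
      refine mem_closure_of_tendsto hgy ?_
      filter_upwards [hcase, hgz] with w haw hw
      refine connectedComponentIn_compl_subset_of_notMem hbz hw.1 (fun hbw => hz ?_) hw.2.2
      rw [connectedComponentIn_eq haC, connectedComponentIn_eq hbC,
        ← connectedComponentIn_eq haw, ← connectedComponentIn_eq hbw]
    exact hb (connectedComponentIn_eq (mem_connectedComponentIn_of_mem_closure hyb hby.symm))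
  · have hcase' : ∀ᶠ w in u, a ∉ connectedComponentIn {z}ᶜ w := Ultrafilter.eventually_not.mpr hcase
    have hxa : x ∈ closure (connectedComponentIn {a}ᶜ z) := by
      refine mem_closure_of_tendsto (f := id) hux ?_
      filter_upwards [hcase', hgz] with w haw hw
      exact connectedComponentIn_compl_subset_of_notMem haz hw.1 haw hw.2.1
    exact ha (connectedComponentIn_eq
      (mem_connectedComponentIn_of_mem_closure hxa hax.symm)).symm

/-- If a continuum is covered by finitely many subcontinua that are cyclically permuted (up to
inclusion) by a continuous map, then removing one of them leaves a connected union. -/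
theorem isPreconnected_iUnion_ne_of_cyclic {X : Type*} [TopologicalSpace X] [PreconnectedSpace X]
    {n : ℕ} [NeZero n] {f : X → X} (hf : Continuous f) {K : ZMod n → Set X}
    (hcl : ∀ i, IsClosed (K i)) (hconn : ∀ i, IsConnected (K i)) (hcov : ⋃ i, K i = univ)
    (hK : ∀ i, MapsTo f (K i) (K (i + 1))) (j : ZMod n) :
    IsPreconnected (⋃ i ∈ {i | i ≠ j}, K i) := by
  have hiter : ∀ (k : ℕ) (i : ZMod n), MapsTo f^[k] (K i) (K (i + k)) := by
    intro k
    induction k with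
    | zero => intro i x hx; simpa using hx
    | succ k ih =>
      intro i x hx
      rw [Function.iterate_succ_apply', Nat.cast_succ, ← add_assoc]
      exact hK _ (ih i hx)
  obtain ⟨I, ⟨hIne, hI⟩, hImax⟩ := (toFinite {I : Set (ZMod n) | I ≠ univ ∧
    IsPreconnected (⋃ i ∈ I, K i)}).exists_maximal
      ⟨∅, empty_ne_univ, by simpa using isPreconnected_empty⟩
  obtain ⟨a, haI, ha⟩ : ∃ a ∉ I, IsPreconnected (⋃ i ∈ insert a I, K i) := by
    obtain rfl | hIn := I.eq_empty_or_nonempty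
    · exact ⟨0, notMem_empty _, by simpa using (hconn 0).isPreconnected⟩
    by_contra! hno
    obtain ⟨b, hb⟩ := (ne_univ_iff_exists_notMem I).mp hIne
    obtain ⟨c, hc⟩ := hIn
    obtain ⟨x, hx⟩ := (hconn b).nonempty
    obtain ⟨y, hy⟩ := (hconn c).nonempty
    obtain ⟨w, -, hw, hw'⟩ := isPreconnected_closed_iff.mp
      (PreconnectedSpace.isPreconnected_univ (α := X)) (⋃ i ∈ I, K i) (⋃ i ∈ Iᶜ, K i)
      ((toFinite I).isClosed_biUnion fun i _ => hcl i)
      ((toFinite Iᶜ).isClosed_biUnion fun i _ => hcl i)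
      (by rw [← biUnion_union, union_compl_self, biUnion_univ, hcov])
      ⟨y, mem_univ y, mem_biUnion hc hy⟩ ⟨x, mem_univ x, mem_biUnion hb hx⟩
    obtain ⟨d, hd, hwd⟩ := mem_iUnion₂.mp hw'
    refine hno d hd ?_
    rw [biUnion_insert]
    exact (hconn d).isPreconnected.union w hwd hw hI
  have hIa : I = {i | i ≠ a} := by
    have huniv : insert a I = univ := by
      by_contra h
      exact haI (hImax ⟨h, ha⟩ (subset_insert a I) (mem_insert a I))
    ext i
    have := huniv ▸ mem_univ i
    constructor
    · rintro hi rfl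
      exact haI hi
    · exact fun hi => (mem_insert_iff.mp this).resolve_left hi
  subst hIa
  set k := (j - a).val with hk
  have hkc : (k : ZMod n) = j - a := ZMod.natCast_zmod_val _
  have himg : IsPreconnected (f^[k] '' ⋃ i ∈ {i | i ≠ a}, K i) :=
    hI.image _ (hf.iterate k).continuousOn
  have hsub : f^[k] '' (⋃ i ∈ {i | i ≠ a}, K i) ⊆ ⋃ i ∈ {i | i ≠ j}, K i := by
    rintro _ ⟨x, hx, rfl⟩
    obtain ⟨i, hi, hxi⟩ := mem_iUnion₂.mp hx
    refine mem_biUnion (x := i + k) (fun h => hi ?_) (hiter k i hxi)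
    rw [hkc] at h
    linear_combination h
  obtain hemp | ⟨i₀, hi₀⟩ := ({i | i ≠ a} : Set (ZMod n)).eq_empty_or_nonempty
  · have : {i : ZMod n | i ≠ j} = ∅ := by
      refine eq_empty_of_forall_notMem fun i hi => ?_
      have h1 : i = a := by_contra fun h => (hemp ▸ (show i ∈ {i | i ≠ a} from h) : i ∈ (∅ : Set _))
      have h2 : j = a := by_contra fun h => (hemp ▸ (show j ∈ {i | i ≠ a} from h) : j ∈ (∅ : Set _))
      exact hi (h1.trans h2.symm)
    rw [this]
    simpa using isPreconnected_empty
  obtain ⟨x₀, hx₀⟩ := (hconn i₀).nonempty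
  refine isPreconnected_of_forall (f^[k] x₀) fun y hy => ?_
  obtain ⟨i, hi, hyi⟩ := mem_iUnion₂.mp hy
  have hia : i - k ≠ a := fun h => hi (by rw [hkc] at h; linear_combination h)
  obtain ⟨v, hv⟩ := (hconn (i - k)).nonempty
  have hfv : f^[k] v ∈ K i := by simpa using hiter k _ hv
  refine ⟨f^[k] '' (⋃ i ∈ {i | i ≠ a}, K i) ∪ K i,
    union_subset hsub (subset_biUnion_of_mem (u := K) hi), Or.inl (mem_image_of_mem _
      (mem_biUnion hi₀ hx₀)), Or.inr hyi, ?_⟩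
  exact himg.union _ (mem_image_of_mem _ (mem_biUnion (x := i - k) hia hv)) hfv
    (hconn i).isPreconnected

theorem IsRegPerDecomp.isClosed {X : Type*} [TopologicalSpace X] {f : X → X} {m : ℕ}
    {Ds : ZMod m → Set X} (h : IsRegPerDecomp f m Ds) (i : ZMod m) : IsClosed (Ds i) := by
  rw [h.2.1 i]
  exact isClosed_closure

theorem IsRegPerDecomp.mapsTo_iterate {X : Type*} [TopologicalSpace X] {f : X → X} {m : ℕ}
    {Ds : ZMod m → Set X} (h : IsRegPerDecomp f m Ds) (k : ℕ) (i : ZMod m) :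
    MapsTo f^[k] (Ds i) (Ds (i + k)) := by
  induction k with
  | zero => intro x hx; simpa using hx
  | succ k ih =>
    intro x hx
    rw [Function.iterate_succ_apply', Nat.cast_succ, ← add_assoc, ← h.2.2.2.1]
    exact mem_image_of_mem f (ih hx)

/-- In a space without isolated points, the tails of a dense orbit are dense. -/
theorem HasDenseOrbit.exists_iterate_mem {X : Type*} [TopologicalSpace X] [T1Space X]
    [∀ x : X, NeBot (𝓝[≠] x)] {f : X → X} {q : X} (hq : HasDenseOrbit f q) {U : Set X}
    (hU : IsOpen U) (hne : U.Nonempty) (N : ℕ) : ∃ k, N < k ∧ f^[k] q ∈ U := by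
  obtain ⟨_, ⟨⟨k, -, rfl⟩, hkN⟩, hkU⟩ :=
    (Dense.sdiff_finite hq ((finite_Iic N).image fun k => f^[k] q)).exists_mem_open hU hne
  exact ⟨k, not_le.mp fun h => hkN ⟨k, h, rfl⟩, hkU⟩

/-- The orbit of a point with dense orbit passes through the pieces of a regular periodic
decomposition strictly cyclically. -/
theorem IsRegPerDecomp.eq_add_of_iterate_mem {X : Type*} [TopologicalSpace X] [T1Space X]
    [BaireSpace X] [Nonempty X] [∀ x : X, NeBot (𝓝[≠] x)] {f : X → X} {m : ℕ}
    {Ds : ZMod m → Set X}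
    (h : IsRegPerDecomp f m Ds) {q : X} (hq : HasDenseOrbit f q) {i j : ZMod m} {k : ℕ}
    (hi : q ∈ Ds i) (hj : f^[k] q ∈ Ds j) : j = i + k := by
  by_contra hne
  have : NeZero m := ⟨h.1.ne'⟩
  let G : {p : ZMod m × ZMod m // p.1 ≠ p.2} → Set X := fun p => (Ds p.1.1 ∩ Ds p.1.2)ᶜ
  have hG : ∀ p, IsOpen (G p) ∧ Dense (G p) := fun p =>
    isClosed_isNowhereDense_iff_compl.mp
      ⟨(h.isClosed _).inter (h.isClosed _), h.2.2.2.2 _ _ p.2⟩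
  obtain ⟨l, hl, hlG⟩ := hq.exists_iterate_mem (isOpen_iInter_of_finite fun p => (hG p).1)
    (dense_iInter_of_isOpen (fun p => (hG p).1) fun p => (hG p).2).nonempty k
  obtain ⟨e, rfl⟩ := Nat.exists_eq_add_of_le' hl.le
  have hne' : j + e ≠ i + ((e + k : ℕ) : ZMod m) := fun h => hne (by
    push_cast at h
    linear_combination h)
  refine mem_iInter.mp hlG ⟨(_, _), hne'⟩ ⟨?_, h.mapsTo_iterate _ _ hi⟩
  rw [Function.iterate_add_apply]
  exact h.mapsTo_iterate _ _ hj

/-- An open set which lies in a piece of a regular periodic decomposition bounds the length of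
that decomposition. -/
theorem HasDenseOrbit.exists_bound_of_subset {X : Type*} [TopologicalSpace X] [T1Space X]
    [BaireSpace X] [Nonempty X] [∀ x : X, NeBot (𝓝[≠] x)] {f : X → X} {q : X}
    (hq : HasDenseOrbit f q)
    {W : Set X} (hW : IsOpen W) (hne : W.Nonempty) :
    ∃ N : ℕ, ∀ (m : ℕ) (Ds : ZMod m → Set X), IsRegPerDecomp f m Ds →
      (∃ j, W ⊆ Ds j) → m ≤ N := by
  obtain ⟨a, -, ha⟩ := hq.exists_iterate_mem hW hne 0
  obtain ⟨b, hab, hb⟩ := hq.exists_iterate_mem hW hne a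
  refine ⟨b - a, fun m Ds h ⟨j, hj⟩ => ?_⟩
  obtain ⟨i, hi⟩ := mem_iUnion.mp (h.2.2.1 ▸ mem_univ q)
  have h1 := h.eq_add_of_iterate_mem hq hi (hj ha)
  have h2 := h.eq_add_of_iterate_mem hq hi (hj hb)
  refine Nat.le_of_dvd (by omega) ((ZMod.natCast_eq_zero_iff _ _).mp ?_)
  rw [Nat.cast_sub hab.le]
  linear_combination h1 - h2

/-- If a dense orbit starts at a cut point `q` of a dendrite, then one of the two sides of `q` lies
in a single piece of any given regular periodic decomposition. -/
theorem IsRegPerDecomp.exists_side_subset {D : Type*} [MetricSpace D] [CompactSpace D]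
    [ConnectedSpace D] (hD : IsDendrite D) {f : D → D} (hf : Continuous f) {q : D}
    (hq : HasDenseOrbit f q) {A B : Set D} (hA : IsOpen A) (hB : IsOpen B) (hAB : Disjoint A B)
    (hcov : {q}ᶜ ⊆ A ∪ B) {m : ℕ} {Ds : ZMod m → Set D} (h : IsRegPerDecomp f m Ds) :
    ∃ j, A ⊆ Ds j ∨ B ⊆ Ds j := by
  have := hD.1
  have : NeZero m := ⟨h.1.ne'⟩
  obtain ⟨i, hi⟩ := mem_iUnion.mp (h.2.2.1 ▸ mem_univ q)
  have huniq : ∀ j, q ∈ Ds j → j = i := fun j hj => by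
    simpa using h.eq_add_of_iterate_mem hq (k := 0) hi hj
  have hnhds : Ds i ∈ 𝓝 q := by
    have hcl : IsClosed (⋃ j ∈ {j | j ≠ i}, Ds j) :=
      (toFinite _).isClosed_biUnion fun j _ => h.isClosed j
    have hqn : q ∉ ⋃ j ∈ {j | j ≠ i}, Ds j := fun hmem => by
      obtain ⟨j, hj, hqj⟩ := mem_iUnion₂.mp hmem
      exact hj (huniq j hqj)
    filter_upwards [hcl.isOpen_compl.mem_nhds hqn] with x hx
    obtain ⟨j, hj⟩ := mem_iUnion.mp (h.2.2.1 ▸ mem_univ x)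
    by_cases hji : j = i
    · exact hji ▸ hj
    · exact absurd (mem_biUnion (show j ∈ {j | j ≠ i} from hji) hj) hx
  set C := connectedComponentIn (Ds i) q with hC
  have hCnhds : C ∈ 𝓝 q := hD.connectedComponentIn_mem_nhds (h.isClosed i) hnhds
  have hqC : q ∈ C := mem_connectedComponentIn hi
  have hCcl : IsClosed C := (h.isClosed i).isClosed_connectedComponentIn q
  have hCconn : IsConnected C := isConnected_connectedComponentIn_iff.mpr hi
  have hCsub : C ⊆ Ds i := connectedComponentIn_subset _ _
  have hret : ∀ (k : ℕ) (x : D), x ∈ C → f^[k] x ∈ C → (k : ZMod m) = 0 → MapsTo f^[k] C C := by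
    intro k x hx hkx hk
    have himg : f^[k] '' C ⊆ Ds i := by
      rintro _ ⟨y, hy, rfl⟩
      simpa [hk] using h.mapsTo_iterate k i (hCsub hy)
    have hsub := (hCconn.isPreconnected.image _
      (hf.iterate k).continuousOn).subset_connectedComponentIn (mem_image_of_mem _ hx) himg
    rw [← connectedComponentIn_eq hkx] at hsub
    exact fun y hy => hsub (mem_image_of_mem _ hy)
  have hex : ∃ n, 0 < n ∧ MapsTo f^[n] C C := by
    obtain ⟨n, hn, hnC⟩ := hq.exists_iterate_mem isOpen_interior
      ⟨q, mem_interior_iff_mem_nhds.mpr hCnhds⟩ 0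
    have hnC' := interior_subset hnC
    refine ⟨n, hn, hret n q hqC hnC' ?_⟩
    simpa using h.eq_add_of_iterate_mem hq hi (hCsub hnC')
  classical
  obtain ⟨hn, hnC⟩ := Nat.find_spec hex
  have hmin : ∀ k < Nat.find hex, 0 < k → ¬ MapsTo f^[k] C C :=
    fun k hk h0 hm => Nat.find_min hex hk ⟨h0, hm⟩
  generalize Nat.find hex = n at hn hnC hmin
  have : NeZero n := ⟨hn.ne'⟩
  let K : ZMod n → Set D := fun a => f^[a.val] '' C
  have hmem : ∀ k : ℕ, f^[k] '' C ⊆ K k := by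
    intro k
    rintro _ ⟨x, hx, rfl⟩
    refine ⟨f^[n * (k / n)] x, ?_, ?_⟩
    · rw [Function.iterate_mul]
      exact hnC.iterate _ hx
    · rw [ZMod.val_natCast, ← Function.iterate_add_apply, Nat.mod_add_div]
  have hKcl : ∀ a, IsClosed (K a) := fun a => (hCcl.isCompact.image (hf.iterate _)).isClosed
  have hKconn : ∀ a, IsConnected (K a) := fun a => hCconn.image _ (hf.iterate _).continuousOn
  have hKcov : ⋃ a, K a = univ := by
    refine eq_univ_of_univ_subset ?_
    rw [← Dense.closure_eq hq]
    refine closure_minimal ?_ (isClosed_iUnion_of_finite hKcl)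
    rintro _ ⟨k, -, rfl⟩
    exact mem_iUnion_of_mem _ (hmem k (mem_image_of_mem _ hqC))
  have hKmaps : ∀ a, MapsTo f (K a) (K (a + 1)) := by
    rintro a _ ⟨x, hx, rfl⟩
    have hx' := hmem (a.val + 1) (mem_image_of_mem _ hx)
    rwa [Nat.cast_succ, ZMod.natCast_zmod_val, Function.iterate_succ_apply'] at hx'
  have hqK : ∀ a, a ≠ 0 → q ∉ K a := by
    rintro a ha ⟨x, hx, hxq⟩
    refine hmin a.val a.val_lt (ZMod.val_pos.mpr ha) (hret _ x hx (hxq ▸ hqC) ?_)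
    have := huniq (i + a.val) (hxq ▸ h.mapsTo_iterate _ _ (hCsub hx))
    simpa using this
  have hK0 : K 0 ⊆ Ds i := by simpa [K] using hCsub
  have hU := isPreconnected_iUnion_ne_of_cyclic hf hKcl hKconn hKcov hKmaps 0
  have hUsub : (⋃ a ∈ {a : ZMod n | a ≠ 0}, K a) ⊆ A ∪ B := fun x hx => by
    obtain ⟨a, ha, hxa⟩ := mem_iUnion₂.mp hx
    exact hcov fun hxq => hqK a ha (hxq ▸ hxa)
  have hside : ∀ {V W : Set D}, Disjoint V W → (⋃ a ∈ {a : ZMod n | a ≠ 0}, K a) ⊆ W →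
      V ⊆ Ds i := fun {V W} hVW hsub x hx => by
    obtain ⟨a, ha⟩ := mem_iUnion.mp (hKcov ▸ mem_univ x)
    by_cases ha0 : a = 0
    · exact hK0 (ha0 ▸ ha)
    · exact absurd (hsub (mem_biUnion (show a ∈ {a | a ≠ 0} from ha0) ha))
        (hVW.notMem_of_mem_left hx)
  obtain hs | hs := hU.subset_or_subset hA hB hAB hUsub
  · exact ⟨i, Or.inr (hside hAB.symm hs)⟩
  · exact ⟨i, Or.inl (hside hAB hs)⟩

/-- A map with a dense orbit on a compact space admits the trivial decomposition. -/
theorem HasDenseOrbit.isRegPerDecomp_one {X : Type*} [TopologicalSpace X] [CompactSpace X]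
    [T2Space X] {f : X → X} (hf : Continuous f) {q : X} (hq : HasDenseOrbit f q) :
    IsRegPerDecomp f 1 (fun _ => univ) := by
  refine ⟨one_pos, fun _ => by simp, iUnion_const _, fun _ => ?_,
    fun i j hij => absurd (Subsingleton.elim i j) hij⟩
  rw [image_univ]
  refine eq_univ_of_univ_subset ?_
  rw [← Dense.closure_eq hq]
  refine closure_minimal ?_ (isCompact_range hf).isClosed
  rintro _ ⟨k, hk, rfl⟩
  obtain ⟨l, rfl⟩ := Nat.exists_eq_add_of_le' hk
  exact ⟨f^[l] q, (Function.iterate_succ_apply' f l q).symm⟩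

/-- A transitive dendrite map with a non-endpoint having dense orbit
admits a terminal regular periodic decomposition. -/
theorem stmt7 {D : Type*} [MetricSpace D] [CompactSpace D] [ConnectedSpace D]
    (hD : IsDendrite D) {f : D → D} (hf : Continuous f) (htrans : TopTransitive f)
    {q : D} (hq : ¬ IsEndpointOf D q) (hdense : HasDenseOrbit f q) :
    HasTerminalDecomp f := by
  have := hD.1
  obtain ⟨A, B, hA, hB, hcov, hAne, hBne, hAB⟩ : ∃ A B : Set D, IsOpen A ∧ IsOpen B ∧
      {q}ᶜ ⊆ A ∪ B ∧ ({q}ᶜ ∩ A).Nonempty ∧ ({q}ᶜ ∩ B).Nonempty ∧ ({q}ᶜ ∩ (A ∩ B)) = ∅ := by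
    simpa [IsEndpointOf, IsPreconnected, not_nonempty_iff_eq_empty] using hq
  have hqo : IsOpen ({q}ᶜ : Set D) := isOpen_compl_singleton
  obtain ⟨N, hN⟩ := hdense.exists_bound_of_subset (hqo.inter hA) hAne
  obtain ⟨M, hM⟩ := hdense.exists_bound_of_subset (hqo.inter hB) hBne
  have hdisj : Disjoint ({q}ᶜ ∩ A) ({q}ᶜ ∩ B) := by
    rw [disjoint_iff_inter_eq_empty, ← inter_inter_distrib_left, hAB]
  have hbound : ∀ m, (∃ Ds : ZMod m → Set D, IsRegPerDecomp f m Ds) → m ≤ max N M := by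
    rintro m ⟨Ds, hDs⟩
    obtain ⟨j, hj | hj⟩ := hDs.exists_side_subset hD hf hdense (hqo.inter hA) (hqo.inter hB)
      hdisj (by rw [← inter_union_distrib_left]; exact subset_inter subset_rfl hcov)
    · exact (hN m Ds hDs ⟨j, hj⟩).trans (le_max_left _ _)
    · exact (hM m Ds hDs ⟨j, hj⟩).trans (le_max_right _ _)
  classical
  obtain ⟨Ds, hDs⟩ := Nat.findGreatest_spec
    (P := fun m => ∃ Ds : ZMod m → Set D, IsRegPerDecomp f m Ds)
    (hbound 1 ⟨_, hdense.isRegPerDecomp_one hf⟩) ⟨_, hdense.isRegPerDecomp_one hf⟩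
  exact ⟨_, Ds, hDs, fun m' Ds' h' => Nat.le_findGreatest (hbound m' ⟨Ds', h'⟩) ⟨Ds', h'⟩⟩
end

section
/- There exist a dendrite X whose set of endpoints End(X) is dense in X, a continuous map F : X → X, and a point b ∈ X \ End(X) such that: (i) F is exact; (ii) F(b) = b; (iii) the set Per(F) of periodic points of F is dense in X; and (iv) Per(F) \ {b} ⊆ End(X). -/
open Set Topology Filter TopologicalSpace

namespace ShiftTree

theorem exists_denseRange_ne_zero :
    ∃ q : ℕ → unitInterval, (∀ n, q n ≠ 0) ∧ DenseRange q := by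
  obtain ⟨s, hs, hd⟩ := TopologicalSpace.exists_countable_dense unitInterval
  have hd' : Dense (s \ {0}) := hd.sdiff_finite (Set.finite_singleton 0)
  obtain ⟨q, hq⟩ := (hs.mono Set.sdiff_subset).exists_eq_range hd'.nonempty
  refine ⟨q, fun n => ?_, by rwa [DenseRange, ← hq]⟩
  have hn : q n ∈ s \ {0} := hq ▸ Set.mem_range_self n
  exact hn.2

/-- The position on every leg at which the `n`-th branch is attached. -/
noncomputable def node : ℕ → unitInterval := exists_denseRange_ne_zero.choose

theorem node_ne_zero (n : ℕ) : node n ≠ 0 :=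
  exists_denseRange_ne_zero.choose_spec.1 n

theorem denseRange_node : DenseRange node :=
  exists_denseRange_ne_zero.choose_spec.2

theorem mapClusterPt_node (t : unitInterval) : MapClusterPt t atTop node := by
  rw [mapClusterPt_iff_frequently]
  intro s hs
  rw [Filter.frequently_atTop]
  intro N
  have hd := denseRange_node.sdiff_finite ((Set.finite_Iio N).image node)
  obtain ⟨_, ⟨⟨n, rfl⟩, hn⟩, hy⟩ := hd.inter_nhds_nonempty hs
  exact ⟨n, not_lt.1 fun h => hn ⟨n, h, rfl⟩, hy⟩

/-- A point of the tree is recorded by its first-point projections to all legs. The legs are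
indexed by nonempty words of natural numbers, the leg `w ++ [j]` being attached to the leg `w`
at the position `node j`; the legs `[j]` are attached to the root. -/
structure IsPoint (x : List ℕ → unitInterval) : Prop where
  nil : x [] = 0
  chain : ∀ v, x v ≠ 0 → v.IsChain (fun i j => i ≤ j + 1)
  comparable : ∀ v w, x v ≠ 0 → x w ≠ 0 → v <+: w ∨ w <+: v
  turn : ∀ w j t, w ≠ [] → x (w ++ j :: t) ≠ 0 → x w = node j

end ShiftTree

/-- The dendrite whose legs are indexed by admissible words. -/
abbrev ShiftTree : Type := {x : List ℕ → unitInterval // ShiftTree.IsPoint x}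

namespace ShiftTree

theorem isClosed_setOf_isPoint : IsClosed {x | IsPoint x} := by
  have h0 : ∀ v : List ℕ, IsClosed {x : List ℕ → unitInterval | x v = 0} := fun v =>
    isClosed_eq (continuous_apply v) continuous_const
  have h : {x | IsPoint x} = {x | x [] = 0} ∩
      (⋂ v, {x | x v = 0} ∪ {_x | v.IsChain (fun i j => i ≤ j + 1)}) ∩
      (⋂ v, ⋂ w, {x | x v = 0} ∪ ({x | x w = 0} ∪ {_x | v <+: w ∨ w <+: v})) ∩
      (⋂ w, ⋂ j, ⋂ t, {_x | w = []} ∪ ({x | x (w ++ j :: t) = 0} ∪ {x | x w = node j})) := by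
    ext x
    simp only [Set.mem_inter_iff, Set.mem_iInter, Set.mem_union, Set.mem_ofPred_eq]
    constructor
    · intro hx
      exact ⟨⟨⟨hx.nil, fun v => or_iff_not_imp_left.2 (hx.chain v)⟩,
        fun v w => or_iff_not_imp_left.2 fun hv => or_iff_not_imp_left.2 (hx.comparable v w hv)⟩,
        fun w j t => or_iff_not_imp_left.2 fun hw => or_iff_not_imp_left.2 (hx.turn w j t hw)⟩
    · rintro ⟨⟨⟨h1, h2⟩, h3⟩, h4⟩
      exact ⟨h1, fun v => or_iff_not_imp_left.1 (h2 v),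
        fun v w hv hw => ((h3 v w).resolve_left hv).resolve_left hw,
        fun w j t hw h => ((h4 w j t).resolve_left hw).resolve_left h⟩
  rw [h]
  refine (((h0 _).inter (isClosed_iInter fun v => (h0 v).union isClosed_const)).inter
    (isClosed_iInter fun v => isClosed_iInter fun w => (h0 v).union ((h0 w).union
      isClosed_const))).inter (isClosed_iInter fun w => isClosed_iInter fun j =>
      isClosed_iInter fun t => isClosed_const.union ((h0 _).union
        (isClosed_eq (continuous_apply w) continuous_const)))

instance : CompactSpace ShiftTree :=
  isCompact_iff_compactSpace.1 isClosed_setOf_isPoint.isCompact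

/-- The root of the tree. -/
def root : ShiftTree :=
  ⟨fun _ => 0, rfl, fun _ h => (h rfl).elim, fun _ _ h => (h rfl).elim,
    fun _ _ _ _ h => (h rfl).elim⟩

theorem continuous_coord (v : List ℕ) : Continuous fun x : ShiftTree => x.1 v :=
  (continuous_apply v).comp continuous_subtype_val

open Classical in
/-- The value at `v` of every point lying beyond the start of the leg `w`, as long as `v` does
not extend `w`. -/
noncomputable def val (w v : List ℕ) : unitInterval :=
  if h : v ≠ [] ∧ ∃ j t, w = v ++ j :: t then node h.2.choose else 0

theorem val_append_cons {v : List ℕ} (hv : v ≠ []) (j : ℕ) (t : List ℕ) :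
    val (v ++ j :: t) v = node j := by
  have h : v ≠ [] ∧ ∃ j' t', v ++ j :: t = v ++ j' :: t' := ⟨hv, j, t, rfl⟩
  rw [val, dif_pos h]
  obtain ⟨t', ht⟩ := h.2.choose_spec
  rw [List.append_cancel_left_eq, List.cons.injEq] at ht
  rw [← ht.1]

theorem val_eq_zero {w v : List ℕ} (h : v = [] ∨ ¬ v <+: w) : val w v = 0 := by
  rw [val, dif_neg]
  rintro ⟨h1, j, t, rfl⟩
  exact h.elim h1 fun h => h (List.prefix_append _ _)

theorem exists_eq_append_cons {v w : List ℕ} (h : v <+: w) (h' : ¬ w <+: v) :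
    ∃ j t, w = v ++ j :: t := by
  obtain ⟨_ | ⟨j, t⟩, rfl⟩ := h
  · simp at h'
  · exact ⟨j, t, rfl⟩

theorem IsPoint.eq_val {x : List ℕ → unitInterval} (hx : IsPoint x) {w v : List ℕ}
    (hw : x w ≠ 0) (hv : ¬ w <+: v) : x v = val w v := by
  by_cases h : v = [] ∨ ¬ v <+: w
  · rw [val_eq_zero h]
    rcases h with rfl | h
    · exact hx.nil
    · by_contra h0
      exact (hx.comparable _ _ hw h0).elim hv h
  · push Not at h
    obtain ⟨j, t, rfl⟩ := exists_eq_append_cons h.2 hv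
    rw [val_append_cons h.1, hx.turn v j t h.1 hw]

theorem IsPoint.ne_zero_of_append {x : List ℕ → unitInterval} (hx : IsPoint x) {v t : List ℕ}
    (hv : v ≠ []) (h : x (v ++ t) ≠ 0) : x v ≠ 0 := by
  rcases t with _ | ⟨j, t⟩
  · simpa using h
  · rw [hx.turn v j t hv h]
    exact node_ne_zero j

/-! ### Arcs from the root -/

/-- The speed profile along the legs of depth `n`: it is positive at depth `m > n` only where it
equals `1` at depth `n`. -/
noncomputable def profile (n : ℕ) (s : ℝ) : unitInterval :=
  Set.projIcc 0 1 zero_le_one (2 ^ (n + 1) * (s - 1) + 2)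

theorem continuous_profile (n : ℕ) : Continuous (profile n) :=
  continuous_projIcc.comp (by fun_prop)

theorem profile_zero (n : ℕ) : profile n 0 = 0 := by
  refine Set.projIcc_of_le_left zero_le_one ?_
  have : (1 : ℝ) ≤ 2 ^ n := one_le_pow₀ (by norm_num)
  rw [pow_succ]
  linarith

theorem profile_one (n : ℕ) : profile n 1 = 1 :=
  Set.projIcc_of_right_le zero_le_one (by norm_num)

theorem profile_eq_one {m n : ℕ} (h : n < m) {s : ℝ} (hs : profile m s ≠ 0) :
    profile n s = 1 := by
  refine Set.projIcc_of_right_le zero_le_one ?_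
  have h1 : 0 < (2 : ℝ) ^ (m + 1) * (s - 1) + 2 := by
    by_contra h0
    exact hs (Set.projIcc_of_le_left zero_le_one (not_lt.1 h0))
  by_contra h2
  have h3 : (2 : ℝ) ^ (n + 1) * (s - 1) < -1 := by linarith
  have h4 : s - 1 < 0 := by
    by_contra h5
    have : 0 ≤ (2 : ℝ) ^ (n + 1) * (s - 1) := mul_nonneg (by positivity) (not_lt.1 h5)
    linarith
  have h5 : (2 : ℝ) ^ (n + 1) * 2 ≤ 2 ^ (m + 1) := by
    rw [← pow_succ]
    exact pow_le_pow_right₀ (by norm_num) (by omega)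
  nlinarith

/-- The path from the root to `x`. -/
noncomputable def path (x : ShiftTree) (s : ℝ) : ShiftTree :=
  ⟨fun v => x.1 v ⊓ profile v.length s, by
    have hl : ∀ a b : unitInterval, a ⊓ b ≠ 0 → a ≠ 0 := by
      rintro a b h rfl
      exact h (inf_eq_left.2 b.2.1)
    have hr : ∀ a b : unitInterval, a ⊓ b ≠ 0 → b ≠ 0 := by
      rintro a b h rfl
      exact h (inf_eq_right.2 a.2.1)
    refine ⟨?_, fun v h => x.2.chain v (hl _ _ h),
      fun v w hv hw => x.2.comparable v w (hl _ _ hv) (hl _ _ hw), fun w j t hw h => ?_⟩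
    · rw [x.2.nil]
      exact inf_eq_left.2 (profile _ s).2.1
    · rw [x.2.turn w j t hw (hl _ _ h),
        profile_eq_one (m := (w ++ j :: t).length) (by simp) (hr _ _ h)]
      exact inf_eq_left.2 (node j).2.2⟩

theorem continuous_path (x : ShiftTree) : Continuous (path x) :=
  Continuous.subtype_mk (continuous_pi fun _ => continuous_const.inf (continuous_profile _)) _

theorem path_zero (x : ShiftTree) : path x 0 = root :=
  Subtype.ext <| funext fun v => by
    change x.1 v ⊓ profile _ 0 = 0
    rw [profile_zero]
    exact inf_eq_right.2 (x.1 v).2.1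

theorem path_one (x : ShiftTree) : path x 1 = x :=
  Subtype.ext <| funext fun v => by
    change x.1 v ⊓ profile _ 1 = x.1 v
    rw [profile_one]
    exact inf_eq_left.2 (x.1 v).2.2

theorem path_le (x : ShiftTree) (s : ℝ) : path x s ≤ x := fun _ => inf_le_left

theorem isPreconnected_of_range_path_subset {S : Set ShiftTree}
    (hS : ∀ x ∈ S, Set.range (path x) ⊆ S) : IsPreconnected S := by
  refine isPreconnected_of_forall root fun x hx => ⟨Set.range (path x), hS x hx,
    ⟨0, path_zero x⟩, ⟨1, path_one x⟩, isPreconnected_range (continuous_path x)⟩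

instance : ConnectedSpace ShiftTree :=
  { isPreconnected_univ := isPreconnected_of_range_path_subset fun _ _ => Set.subset_univ _
    toNonempty := ⟨root⟩ }

theorem isEndpointOf_of_maximal {p : ShiftTree}
    (hmax : ∀ x, p ≤ x → x = p) : IsEndpointOf ShiftTree p := by
  refine isPreconnected_of_range_path_subset fun x hx => ?_
  rintro _ ⟨s, rfl⟩ h
  have h : path x s = p := h
  exact hx (hmax x (h ▸ path_le x s))

/-! ### Separation -/

theorem eq_of_coord_eq {x y : ShiftTree} {w : List ℕ} (h : x.1 w = y.1 w) (h0 : x.1 w ≠ 0)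
    (hn : ∀ j, x.1 w ≠ node j) : x = y := by
  refine Subtype.ext <| funext fun v => ?_
  by_cases hv : w <+: v
  · obtain ⟨_ | ⟨j, t⟩, rfl⟩ := hv
    · simpa using h
    · have hw : w ≠ [] := by
        rintro rfl
        exact h0 x.2.nil
      have hx : x.1 (w ++ j :: t) = 0 := by
        by_contra h'
        exact hn j (x.2.turn w j t hw h')
      have hy : y.1 (w ++ j :: t) = 0 := by
        by_contra h'
        exact hn j (h.trans (y.2.turn w j t hw h'))
      rw [hx, hy]
  · rw [x.2.eq_val h0 hv, y.2.eq_val (h ▸ h0) hv]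

theorem exists_separating_of_coord_lt {x y : ShiftTree} {w : List ℕ} (h : x.1 w < y.1 w) :
    ∃ z : ShiftTree, z ≠ x ∧ z ≠ y ∧
      connectedComponentIn ({z}ᶜ : Set ShiftTree) x ≠
        connectedComponentIn ({z}ᶜ : Set ShiftTree) y := by
  have hI : (Set.Ioo (x.1 w) (y.1 w) \ Set.range node).Nonempty := by
    by_contra hne
    rw [Set.not_nonempty_iff_eq_empty, Set.sdiff_eq_empty] at hne
    have hc : (Set.Ioo (x.1 w) (y.1 w)).Countable := (Set.countable_range node).mono hne
    have hR : Set.Ioo (x.1 w : ℝ) (y.1 w) ⊆ Subtype.val '' Set.Ioo (x.1 w) (y.1 w) := by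
      intro r hr
      exact ⟨⟨r, (x.1 w).2.1.trans hr.1.le, hr.2.le.trans (y.1 w).2.2⟩, hr, rfl⟩
    exact Cardinal.Real.Ioo_countable_iff.not.2 (not_le.2 h) ((hc.image _).mono hR)
  obtain ⟨s, ⟨hxs, hsy⟩, hs⟩ := hI
  obtain ⟨z, hz⟩ := mem_range_of_exists_le_of_exists_ge (continuous_coord w)
    ⟨x, hxs.le⟩ ⟨y, hsy.le⟩
  have hz : z.1 w = s := hz
  have hzx : z ≠ x := by
    rintro rfl
    exact hxs.ne hz
  have hzy : z ≠ y := by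
    rintro rfl
    exact hsy.ne' hz
  refine ⟨z, hzx, hzy, fun heq => ?_⟩
  have hyC : y ∈ connectedComponentIn ({z}ᶜ : Set ShiftTree) x :=
    heq ▸ mem_connectedComponentIn hzy.symm
  obtain ⟨u, hu, hus⟩ := (isPreconnected_connectedComponentIn (x := x)
    (F := ({z}ᶜ : Set ShiftTree))).intermediate_value
    (mem_connectedComponentIn hzx.symm) hyC (continuous_coord w).continuousOn ⟨hxs.le, hsy.le⟩
  have hus : u.1 w = s := hus
  refine connectedComponentIn_subset _ _ hu (eq_of_coord_eq (hus.trans hz.symm) ?_ ?_)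
  · rw [hus]
    exact (lt_of_le_of_lt unitInterval.nonneg' hxs).ne'
  · rw [hus]
    exact fun j hj => hs ⟨j, hj.symm⟩

theorem exists_separating {x y : ShiftTree} (h : x ≠ y) :
    ∃ z : ShiftTree, z ≠ x ∧ z ≠ y ∧
      connectedComponentIn ({z}ᶜ : Set ShiftTree) x ≠
        connectedComponentIn ({z}ᶜ : Set ShiftTree) y := by
  obtain ⟨w, hw⟩ : ∃ w, x.1 w ≠ y.1 w := by
    by_contra! h'
    exact h (Subtype.ext (funext h'))
  rcases lt_or_gt_of_ne hw with hlt | hlt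
  · exact exists_separating_of_coord_lt hlt
  · obtain ⟨z, hx, hy, hz⟩ := exists_separating_of_coord_lt hlt
    exact ⟨z, hy, hx, hz.symm⟩

/-! ### Small subtrees -/

theorem exists_subtree_subset_of_tendsto {ι : Type*} {l : Filter ι} [l.NeBot] {x : ShiftTree}
    {W : ι → List ℕ} {P : ι → Prop} (hP : ∀ᶠ n in l, P n)
    (hval : ∀ v, Tendsto (fun n => val (W n) v) l (𝓝 (x.1 v)))
    (hW : ∀ v, ∀ᶠ n in l, ¬ W n <+: v) {U : Set ShiftTree} (hU : U ∈ 𝓝 x) :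
    ∃ n, P n ∧ {u : ShiftTree | u.1 (W n) ≠ 0} ⊆ U := by
  by_contra! h
  have h' : ∀ n, ∃ u : ShiftTree, P n → u.1 (W n) ≠ 0 ∧ u ∉ U := by
    intro n
    by_cases hn : P n
    · obtain ⟨u, hu, hu'⟩ := Set.not_subset.1 (h n hn)
      exact ⟨u, fun _ => ⟨hu, hu'⟩⟩
    · exact ⟨x, fun h => (hn h).elim⟩
  choose u hu using h'
  have hlim : Tendsto u l (𝓝 x) := by
    rw [tendsto_subtype_rng, tendsto_pi_nhds]
    intro v
    refine (hval v).congr' ?_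
    filter_upwards [hP, hW v] with n hn hn'
    exact ((u n).2.eq_val (hu n hn).1 hn').symm
  obtain ⟨n, hn, hn'⟩ := (hP.and (hlim hU)).exists
  exact (hu n hn).2 hn'

theorem isChain_append_singleton {w : List ℕ} (hw : w.IsChain fun i j => i ≤ j + 1) :
    ∀ᶠ n in atTop, (w ++ [n]).IsChain fun i j => i ≤ j + 1 := by
  filter_upwards [eventually_ge_atTop w.sum] with n hn
  refine List.isChain_append.2 ⟨hw, by simp, fun i hi j hj => ?_⟩
  have h1 : i ≤ w.sum := List.single_le_sum (by simp) i (List.mem_of_mem_getLast? hi)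
  have h2 : n = j := by simpa using hj
  omega

theorem exists_coord_ne_zero {x : ShiftTree} (hx : x ≠ root) : ∃ w, x.1 w ≠ 0 := by
  by_contra! h
  exact hx (Subtype.ext (funext h))

theorem eventually_not_append_singleton_prefix (w v : List ℕ) :
    ∀ᶠ n in atTop, ¬ w ++ [n] <+: v := by
  filter_upwards [eventually_gt_atTop v.sum] with n hn h
  have : n ∈ v := h.subset (by simp)
  exact absurd (List.single_le_sum (by simp) n this) (by omega)

theorem exists_subtree_subset {x : ShiftTree} {U : Set ShiftTree} (hU : U ∈ 𝓝 x) :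
    ∃ w : List ℕ, (w ≠ [] ∧ w.IsChain fun i j => i ≤ j + 1) ∧
      {u : ShiftTree | u.1 w ≠ 0} ⊆ U := by
  by_cases hx : x = root
  · subst hx
    obtain ⟨n, hn, h⟩ := exists_subtree_subset_of_tendsto (l := atTop) (W := fun n => [n])
      (P := fun _ => True) (Eventually.of_forall fun _ => trivial)
      (fun v => by
        refine tendsto_const_nhds.congr fun n => ?_
        change 0 = val [n] v
        rw [val, dif_neg]
        rintro ⟨hv, j, t, h⟩
        rcases v with _ | ⟨k, v⟩ <;> simp at hv h)
      (eventually_not_append_singleton_prefix []) hU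
    exact ⟨[n], by simp, h⟩
  by_cases hfin : ∃ w, x.1 w ≠ 0 ∧ ∀ j, x.1 (w ++ [j]) = 0
  · obtain ⟨w, hw, hw'⟩ := hfin
    have hw0 : w ≠ [] := by
      rintro rfl
      exact hw x.2.nil
    obtain ⟨F, hF, hlim⟩ := mapClusterPt_iff_ultrafilter.1 (mapClusterPt_node (x.1 w))
    obtain ⟨n, hn, h⟩ := exists_subtree_subset_of_tendsto (x := x) (l := (F : Filter ℕ))
      (W := fun n => w ++ [n])
      (hF (isChain_append_singleton (x.2.chain w hw)))
      (fun v => by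
        by_cases hv : v = w
        · subst hv
          simpa only [val_append_cons hw0] using hlim
        · refine tendsto_const_nhds.congr' ?_
          filter_upwards [hF (eventually_not_append_singleton_prefix w v)] with n hn
          by_cases hwv : w <+: v
          · obtain ⟨_ | ⟨j, t⟩, rfl⟩ := hwv
            · simp at hv
            · have h0 : x.1 (w ++ j :: t) = 0 := by
                by_contra h0
                refine x.2.ne_zero_of_append (v := w ++ [j]) (t := t) (by simp) ?_ (hw' j)
                simpa using h0
              rw [h0, val_eq_zero]
              refine Or.inr fun hp => ?_
              simp only [List.prefix_append_right_inj, List.cons_prefix_cons] at hp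
              exact hn (by simp [hp.1])
          · rw [x.2.eq_val hw hwv]
            by_cases h : v = [] ∨ ¬ v <+: w
            · rw [val_eq_zero h, val_eq_zero]
              refine h.imp_right fun h hp => ?_
              rcases List.prefix_concat_iff.1 hp with rfl | hp
              · exact hn (List.prefix_refl _)
              · exact h hp
            · push Not at h
              obtain ⟨j, t, rfl⟩ := exists_eq_append_cons h.2 hwv
              rw [val_append_cons h.1, List.append_assoc, List.cons_append,
                val_append_cons h.1])
      (fun v => hF (eventually_not_append_singleton_prefix w v)) hU
    exact ⟨w ++ [n], ⟨by simp, hn⟩, h⟩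
  · push Not at hfin
    have hlong : ∀ n : ℕ, ∃ w, x.1 w ≠ 0 ∧ n ≤ w.length := by
      intro n
      induction n with
      | zero => exact (exists_coord_ne_zero hx).imp fun w hw => ⟨hw, Nat.zero_le _⟩
      | succ n ih =>
        obtain ⟨w, hw, hn⟩ := ih
        obtain ⟨j, hj⟩ := hfin w hw
        exact ⟨w ++ [j], hj, by simpa using hn⟩
    choose W hW hlen using hlong
    have hpre : ∀ v, ∀ᶠ n in atTop, ¬ W n <+: v := fun v => by
      filter_upwards [eventually_gt_atTop v.length] with n hn h
      have := h.length_le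
      have := hlen n
      omega
    obtain ⟨n, -, h⟩ := exists_subtree_subset_of_tendsto (x := x) (l := atTop) (W := W)
      (P := fun _ => True) (Eventually.of_forall fun _ => trivial)
      (fun v => by
        refine tendsto_const_nhds.congr' ?_
        filter_upwards [hpre v] with n hn
        exact x.2.eq_val (hW n) hn) hpre hU
    refine ⟨W n, ⟨fun h0 => hW n ?_, x.2.chain _ (hW n)⟩, h⟩
    rw [h0, x.2.nil]

/-! ### The shift -/

/-- Coordinates of the image under the shift, which collapses the first legs to the root. -/
noncomputable def shiftFun (x : List ℕ → unitInterval) : List ℕ → unitInterval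
  | [] => 0
  | j :: t => (Finset.range (j + 2)).sup fun i => x (i :: j :: t)

theorem exists_of_shiftFun_ne_zero {x : List ℕ → unitInterval} {v : List ℕ}
    (h : shiftFun x v ≠ 0) : v ≠ [] ∧ ∃ i, x (i :: v) ≠ 0 := by
  rcases v with _ | ⟨j, t⟩
  · exact (h rfl).elim
  · refine ⟨by simp, ?_⟩
    by_contra! h'
    refine h (le_antisymm (Finset.sup_le fun i _ => (h' i).le) unitInterval.nonneg')

theorem IsPoint.shiftFun_eq {x : List ℕ → unitInterval} (hx : IsPoint x) {v : List ℕ} {i : ℕ}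
    (hv : v ≠ []) (h : x (i :: v) ≠ 0) : shiftFun x v = x (i :: v) := by
  rcases v with _ | ⟨j, t⟩
  · exact (hv rfl).elim
  · refine le_antisymm (Finset.sup_le fun k _ => ?_) ?_
    · by_cases hk : x (k :: j :: t) = 0
      · rw [hk]
        exact unitInterval.nonneg'
      · have : k = i := by
          rcases hx.comparable _ _ hk h with h | h <;> simp_all [List.cons_prefix_cons]
        rw [this]
    · have hc := hx.chain _ h
      rw [List.isChain_cons_cons] at hc
      exact Finset.le_sup (f := fun i => x (i :: j :: t)) (Finset.mem_range.2 (by omega))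

theorem IsPoint.shiftFun {x : List ℕ → unitInterval} (hx : IsPoint x) :
    IsPoint (shiftFun x) := by
  refine ⟨rfl, fun v hv => ?_, fun v w hv hw => ?_, fun w j t hw h => ?_⟩
  · obtain ⟨-, i, hi⟩ := exists_of_shiftFun_ne_zero hv
    exact (hx.chain _ hi).tail
  · obtain ⟨-, i, hi⟩ := exists_of_shiftFun_ne_zero hv
    obtain ⟨-, k, hk⟩ := exists_of_shiftFun_ne_zero hw
    exact (hx.comparable _ _ hi hk).imp (fun h => (List.cons_prefix_cons.1 h).2)
      fun h => (List.cons_prefix_cons.1 h).2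
  · obtain ⟨-, i, hi⟩ := exists_of_shiftFun_ne_zero h
    have h1 : x (i :: w) = node j := hx.turn (i :: w) j t (by simp) hi
    rw [hx.shiftFun_eq hw (h1 ▸ node_ne_zero j), h1]

/-- The shift map of the tree. -/
noncomputable def shift (x : ShiftTree) : ShiftTree := ⟨shiftFun x.1, x.2.shiftFun⟩

theorem continuous_shift : Continuous shift := by
  refine Continuous.subtype_mk (continuous_pi fun v => ?_) _
  rcases v with _ | ⟨j, t⟩
  · exact continuous_const
  · exact Continuous.finset_sup_apply fun i _ => continuous_coord _

theorem shift_root : shift root = root := by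
  by_contra h
  obtain ⟨w, hw⟩ := exists_coord_ne_zero h
  obtain ⟨-, i, hi⟩ := exists_of_shiftFun_ne_zero hw
  exact hi rfl

theorem iterate_shift_eq_root {x : ShiftTree} {n : ℕ} (h : ∀ v, n < v.length → x.1 v = 0) :
    shift^[n] x = root := by
  induction n generalizing x with
  | zero =>
    by_contra h0
    obtain ⟨w, hw⟩ := exists_coord_ne_zero h0
    refine hw (h w (List.length_pos_iff.2 ?_))
    rintro rfl
    exact hw x.2.nil
  | succ n ih =>
    rw [Function.iterate_succ_apply]
    refine ih fun v hv => ?_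
    by_contra h0
    obtain ⟨-, i, hi⟩ := exists_of_shiftFun_ne_zero h0
    exact hi (h _ (by simpa using hv))

theorem isEndpointOf_of_isPeriodic {x : ShiftTree} (hx : IsPeriodic shift x) (h0 : x ≠ root) :
    IsEndpointOf ShiftTree x := by
  have hlong : ∀ n, ∃ v, n < v.length ∧ x.1 v ≠ 0 := by
    by_contra! h
    obtain ⟨n, hn⟩ := h
    obtain ⟨p, hp, hpx⟩ := hx
    refine h0 ?_
    have h1 : shift^[p * n] x = x := by
      rw [Function.iterate_mul]
      exact Function.iterate_fixed hpx n
    rw [← h1]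
    exact iterate_shift_eq_root fun v hv => hn v (lt_of_le_of_lt (Nat.le_mul_of_pos_left n hp) hv)
  refine isEndpointOf_of_maximal fun y hy => Subtype.ext <| funext fun w => ?_
  obtain ⟨v, hv, hxv⟩ := hlong w.length
  have hpre : ¬ v <+: w := fun h => by
    have := h.length_le
    omega
  have hyv : y.1 v ≠ 0 := fun h => hxv (le_antisymm (h ▸ hy v) unitInterval.nonneg')
  rw [x.2.eq_val hxv hpre, y.2.eq_val hyv hpre]

/-! ### Periodic points -/

open Classical in
/-- Coordinates of the infinite path following the legs named by the sequence `a`. -/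
noncomputable def seqFun (a : ℕ → ℕ) (v : List ℕ) : unitInterval :=
  if v ≠ [] ∧ ∀ k (h : k < v.length), v[k] = a k then node (a v.length) else 0

theorem seqFun_ne_zero_iff {a : ℕ → ℕ} {v : List ℕ} :
    seqFun a v ≠ 0 ↔ v ≠ [] ∧ ∀ k (h : k < v.length), v[k] = a k := by
  rw [seqFun]
  split_ifs with h
  · exact iff_of_true (node_ne_zero _) h
  · exact iff_of_false (fun h => h rfl) h

theorem seqFun_of {a : ℕ → ℕ} {v : List ℕ} (h : v ≠ [])
    (h' : ∀ k (h : k < v.length), v[k] = a k) : seqFun a v = node (a v.length) :=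
  if_pos ⟨h, h'⟩

theorem isPoint_seqFun {a : ℕ → ℕ} (ha : ∀ n, a n ≤ a (n + 1) + 1) : IsPoint (seqFun a) := by
  refine ⟨if_neg (by simp), fun v hv => ?_, fun v w hv hw => ?_, fun w j t hw h => ?_⟩
  · rw [seqFun_ne_zero_iff] at hv
    rw [List.isChain_iff_getElem]
    intro k hk
    rw [hv.2, hv.2]
    exact ha k
  · rw [seqFun_ne_zero_iff] at hv hw
    have key : ∀ v w : List ℕ, (∀ k (h : k < v.length), v[k] = a k) →
        (∀ k (h : k < w.length), w[k] = a k) → v.length ≤ w.length → v <+: w := by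
      intro v w hv hw h
      rw [List.prefix_iff_getElem]
      exact ⟨h, fun k hk => by rw [hv, hw]⟩
    exact (le_total v.length w.length).imp (key v w hv.2 hw.2) (key w v hw.2 hv.2)
  · rw [seqFun_ne_zero_iff] at h
    have h1 : a w.length = j := by
      rw [← h.2 w.length (by simp)]
      simp
    rw [seqFun_of hw, h1]
    intro k hk
    rw [← h.2 k (by simp; omega), List.getElem_append_left hk]

theorem shiftFun_seqFun {a : ℕ → ℕ} (ha : ∀ n, a n ≤ a (n + 1) + 1) :
    shiftFun (seqFun a) = seqFun fun n => a (n + 1) := by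
  have hp := isPoint_seqFun ha
  funext v
  by_cases h : seqFun (fun n => a (n + 1)) v = 0
  · rw [h]
    by_contra h0
    obtain ⟨hv, i, hi⟩ := exists_of_shiftFun_ne_zero h0
    refine seqFun_ne_zero_iff.2 ⟨hv, fun k hk => ?_⟩ h
    have := (seqFun_ne_zero_iff.1 hi).2 (k + 1) (by simpa using hk)
    simpa using this
  · obtain ⟨hv, hv'⟩ := seqFun_ne_zero_iff.1 h
    have h1 : seqFun a (a 0 :: v) = node (a (v.length + 1)) := by
      refine seqFun_of (by simp) fun k hk => ?_
      rcases k with _ | k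
      · rfl
      · exact hv' k (by simpa using hk)
    rw [hp.shiftFun_eq hv (h1 ▸ node_ne_zero _), h1, seqFun_of hv hv']

theorem exists_chain_to_zero (l : ℕ) :
    ∃ u : List ℕ, (l :: u).IsChain (fun i j => i ≤ j + 1) ∧ (l :: u).getLast? = some 0 := by
  induction l with
  | zero => exact ⟨[], by simp, by simp⟩
  | succ l ih =>
    obtain ⟨u, hu, hu'⟩ := ih
    exact ⟨l :: u, by simpa [List.isChain_cons_cons] using hu, by simpa using hu'⟩

theorem exists_periodic_sequence {w : List ℕ} (hw : w ≠ [])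
    (hc : w.IsChain fun i j => i ≤ j + 1) :
    ∃ (a : ℕ → ℕ) (p : ℕ), 1 ≤ p ∧ (∀ n, a (n + p) = a n) ∧ (∀ n, a n ≤ a (n + 1) + 1) ∧
      ∀ k (h : k < w.length), w[k] = a k := by
  obtain ⟨w, l, rfl⟩ := (List.eq_nil_or_concat' w).resolve_left hw
  obtain ⟨u, hu, hu'⟩ := exists_chain_to_zero l
  have hp : (w ++ l :: u).IsChain fun i j => i ≤ j + 1 :=
    List.isChain_split.2 ⟨hc, hu⟩
  set p := w ++ l :: u with hpdef
  have hlen : 0 < p.length := by simp [hpdef]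
  have hlast : p[p.length - 1]'(by omega) = 0 := by
    have h : p.getLast? = some 0 := by
      rw [hpdef, List.getLast?_append, hu']
      rfl
    rw [List.getLast?_eq_getElem?] at h
    exact (List.getElem?_eq_some_iff.1 h).2
  refine ⟨fun n => p[n % p.length]'(Nat.mod_lt _ hlen), p.length, hlen, fun n => by simp,
    fun n => ?_, fun k hk => ?_⟩
  · have hm := Nat.mod_lt n hlen
    by_cases h : n % p.length = p.length - 1
    · simp [h, hlast]
    · have h1 : (n + 1) % p.length = n % p.length + 1 := by
        rw [Nat.add_mod, Nat.mod_eq_of_lt (a := 1) (by omega), Nat.mod_eq_of_lt (by omega)]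
      simp only [h1]
      exact List.isChain_iff_getElem.1 hp _ (by omega)
  · have hk' : k < p.length := by
      simp [hpdef] at hk ⊢
      omega
    simp only [Nat.mod_eq_of_lt hk']
    have : p = (w ++ [l]) ++ u := by simp [hpdef]
    simp only [this]
    rw [List.getElem_append_left hk]

theorem exists_isPeriodic_coord_ne_zero {w : List ℕ} (hw : w ≠ [])
    (hc : w.IsChain fun i j => i ≤ j + 1) :
    ∃ x : ShiftTree, IsPeriodic shift x ∧ x.1 w ≠ 0 := by
  obtain ⟨a, p, hp, hper, ha, haw⟩ := exists_periodic_sequence hw hc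
  have ha' : ∀ m n, a (n + m) ≤ a (n + 1 + m) + 1 := fun m n => by
    rw [show n + 1 + m = n + m + 1 by omega]
    exact ha _
  have hiter : ∀ m, (shift^[m] ⟨seqFun a, isPoint_seqFun ha⟩ : ShiftTree) =
      ⟨seqFun fun n => a (n + m), isPoint_seqFun (ha' m)⟩ := by
    intro m
    induction m with
    | zero => rfl
    | succ m ih =>
      rw [Function.iterate_succ_apply', ih]
      refine Subtype.ext ((shiftFun_seqFun (ha' m)).trans ?_)
      congr 1
      funext n
      congr 1
      omega
  refine ⟨⟨seqFun a, isPoint_seqFun ha⟩, ⟨p, hp, ?_⟩, seqFun_ne_zero_iff.2 ⟨hw, haw⟩⟩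
  rw [hiter]
  exact Subtype.ext (congrArg seqFun (funext hper))

/-! ### Exactness -/

/-- Coordinates of the point obtained by prefixing a leg `i`, followed up to the position `s`. -/
def graftFun (i : ℕ) (s : unitInterval) (y : List ℕ → unitInterval) : List ℕ → unitInterval
  | [] => 0
  | [k] => if k = i then s else 0
  | k :: j :: t => if k = i then y (j :: t) else 0

theorem graftFun_ne_zero {i : ℕ} {s : unitInterval} {y : List ℕ → unitInterval} {v : List ℕ}
    (h : graftFun i s y v ≠ 0) : ∃ t, v = i :: t ∧ (t ≠ [] → y t ≠ 0) := by
  rcases v with _ | ⟨k, _ | ⟨j, t⟩⟩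
  · exact (h rfl).elim
  · by_cases hk : k = i
    · exact ⟨[], by rw [hk], by simp⟩
    · simp [graftFun, hk] at h
  · by_cases hk : k = i
    · refine ⟨j :: t, by rw [hk], fun _ => ?_⟩
      simpa [graftFun, hk] using h
    · simp [graftFun, hk] at h

theorem graftFun_cons {i : ℕ} {s : unitInterval} {y : List ℕ → unitInterval} {v : List ℕ}
    (hv : v ≠ []) : graftFun i s y (i :: v) = y v := by
  rcases v with _ | ⟨j, t⟩
  · exact (hv rfl).elim
  · simp [graftFun]

theorem IsPoint.graftFun {i : ℕ} {s : unitInterval} {y : List ℕ → unitInterval}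
    (hy : IsPoint y) (h : ∀ j t, y (j :: t) ≠ 0 → i ≤ j + 1 ∧ s = node j) :
    IsPoint (graftFun i s y) := by
  refine ⟨rfl, fun v hv => ?_, fun v w hv hw => ?_, fun w j t hw hwj => ?_⟩
  · obtain ⟨_ | ⟨j, t⟩, rfl, ht⟩ := graftFun_ne_zero hv
    · simp
    · have ht := ht (by simp)
      exact List.isChain_cons_cons.2 ⟨(h j t ht).1, hy.chain _ ht⟩
  · obtain ⟨v, rfl, hyv⟩ := graftFun_ne_zero hv
    obtain ⟨w, rfl, hyw⟩ := graftFun_ne_zero hw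
    simp only [List.cons_prefix_cons, true_and]
    by_cases hv0 : v = []
    · simp [hv0]
    by_cases hw0 : w = []
    · simp [hw0]
    exact hy.comparable v w (hyv hv0) (hyw hw0)
  · obtain ⟨u, hu, hyu⟩ := graftFun_ne_zero hwj
    rcases w with _ | ⟨k, w⟩
    · exact (hw rfl).elim
    · simp only [List.cons_append, List.cons.injEq] at hu
      obtain ⟨rfl, rfl⟩ := hu
      have hyu := hyu (by simp)
      rcases w with _ | ⟨m, w⟩
      · simpa [ShiftTree.graftFun] using (h j t hyu).2
      · rw [graftFun_cons (by simp)]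
        exact hy.turn _ j t (by simp) hyu

theorem IsPoint.shiftFun_graftFun {i : ℕ} {s : unitInterval} {y : List ℕ → unitInterval}
    (hy : IsPoint y) (h : ∀ j t, y (j :: t) ≠ 0 → i ≤ j + 1 ∧ s = node j) :
    ShiftTree.shiftFun (ShiftTree.graftFun i s y) = y := by
  funext v
  by_cases hv : v = []
  · rw [hv, hy.nil]
    rfl
  by_cases hyv : y v = 0
  · rw [hyv]
    by_contra h0
    obtain ⟨-, k, hk⟩ := exists_of_shiftFun_ne_zero h0
    obtain ⟨t, ht, hyt⟩ := graftFun_ne_zero hk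
    obtain ⟨-, rfl⟩ := List.cons.inj ht
    exact hyt hv hyv
  · have h1 := graftFun_cons (i := i) (s := s) (y := y) hv
    rw [(hy.graftFun h).shiftFun_eq hv (h1.symm ▸ hyv), h1]

theorem IsPoint.head_eq {y : List ℕ → unitInterval} (hy : IsPoint y) {j k : ℕ} {s t : List ℕ}
    (hj : y (j :: s) ≠ 0) (hk : y (k :: t) ≠ 0) : j = k := by
  rcases hy.comparable _ _ hj hk with h | h
  · exact (List.cons_prefix_cons.1 h).1
  · exact (List.cons_prefix_cons.1 h).1.symm

theorem coord_ne_zero_subset_image_shift {i j : ℕ} {t : List ℕ} (hij : i ≤ j + 1) :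
    {y : ShiftTree | y.1 (j :: t) ≠ 0} ⊆ shift '' {x | x.1 (i :: j :: t) ≠ 0} := by
  intro y hy
  have h : ∀ k s, y.1 (k :: s) ≠ 0 → i ≤ k + 1 ∧ node j = node k := by
    intro k s hk
    obtain rfl := y.2.head_eq hy hk
    exact ⟨hij, rfl⟩
  refine ⟨⟨graftFun i (node j) y.1, y.2.graftFun h⟩, ?_, Subtype.ext (y.2.shiftFun_graftFun h)⟩
  simpa [graftFun] using hy

/-- The union of the root and the branches `[j]` with `k ≤ j`. -/
def tail (k : ℕ) : Set ShiftTree := {y | ∀ j t, y.1 (j :: t) ≠ 0 → k ≤ j}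

theorem tail_subset_image_shift (i : ℕ) :
    tail (i - 1) ⊆ shift '' {x | x.1 [i] ≠ 0} := by
  intro y hy
  have key : ∃ s : unitInterval, s ≠ 0 ∧ ∀ j t, y.1 (j :: t) ≠ 0 → i ≤ j + 1 ∧ s = node j := by
    by_cases h : ∃ j t, y.1 (j :: t) ≠ 0
    · obtain ⟨j, t, h⟩ := h
      refine ⟨node j, node_ne_zero j, fun k s hk => ?_⟩
      obtain rfl := y.2.head_eq h hk
      have := hy j t h
      exact ⟨by omega, rfl⟩
    · push Not at h
      exact ⟨1, one_ne_zero, fun j t h' => (h' (h j t)).elim⟩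
  obtain ⟨s, hs, h⟩ := key
  refine ⟨⟨graftFun i s y.1, y.2.graftFun h⟩, ?_, Subtype.ext (y.2.shiftFun_graftFun h)⟩
  simpa [graftFun] using hs

theorem image_iterate_succ_eq_univ {S T : Set ShiftTree} {N : ℕ} (hS : S ⊆ shift '' T)
    (h : shift^[N] '' S = Set.univ) : shift^[N + 1] '' T = Set.univ := by
  rw [Function.iterate_succ, Set.image_comp]
  exact Set.univ_subset_iff.1 (h ▸ Set.image_mono hS)

theorem exists_iterate_image_tail (k : ℕ) : ∃ N, shift^[N] '' tail k = Set.univ := by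
  induction k with
  | zero => exact ⟨0, by simp [tail]⟩
  | succ k ih =>
    obtain ⟨N, hN⟩ := ih
    refine ⟨N + 1, image_iterate_succ_eq_univ ((tail_subset_image_shift (k + 1)).trans
      (Set.image_mono fun x hx j t hj => ?_)) hN⟩
    exact (x.2.head_eq hx hj).le

theorem exists_iterate_image_eq_univ {w : List ℕ} (hw : w ≠ [])
    (hc : w.IsChain fun i j => i ≤ j + 1) :
    ∃ N, 0 < N ∧ shift^[N] '' {x | x.1 w ≠ 0} = Set.univ := by
  induction w with
  | nil => exact (hw rfl).elim
  | cons i w ih =>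
    rcases w with _ | ⟨j, t⟩
    · obtain ⟨N, hN⟩ := exists_iterate_image_tail (i - 1)
      exact ⟨N + 1, N.succ_pos, image_iterate_succ_eq_univ (tail_subset_image_shift i) hN⟩
    · rw [List.isChain_cons_cons] at hc
      obtain ⟨N, -, hN⟩ := ih (by simp) hc.2
      exact ⟨N + 1, N.succ_pos,
        image_iterate_succ_eq_univ (coord_ne_zero_subset_image_shift hc.1) hN⟩

theorem topExact_shift : TopExact shift := by
  rintro U hU ⟨x, hx⟩
  obtain ⟨w, ⟨hw, hc⟩, hwU⟩ := exists_subtree_subset (hU.mem_nhds hx)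
  obtain ⟨N, hN, h⟩ := exists_iterate_image_eq_univ hw hc
  exact ⟨N, hN, Set.univ_subset_iff.1 (h ▸ Set.image_mono hwU)⟩

theorem exists_coord_singleton_ne_zero (i : ℕ) : ∃ x : ShiftTree, x.1 [i] ≠ 0 :=
  (exists_isPeriodic_coord_ne_zero (w := [i]) (by simp) (by simp)).imp fun _ h => h.2

theorem not_isEndpointOf_root : ¬ IsEndpointOf ShiftTree root := by
  intro h
  have hopen : ∀ i : ℕ, IsOpen {x : ShiftTree | x.1 [i] ≠ 0} := fun i =>
    isOpen_ne_fun (continuous_coord [i]) continuous_const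
  have hroot : ∀ {x : ShiftTree} {i : ℕ}, x.1 [i] ≠ 0 → x ∈ ({root}ᶜ : Set ShiftTree) := by
    rintro x i hx rfl
    exact hx rfl
  obtain ⟨x, hx⟩ := exists_coord_singleton_ne_zero 0
  obtain ⟨y, hy⟩ := exists_coord_singleton_ne_zero 1
  obtain ⟨z, -, hz0, hz⟩ := h {x | x.1 [0] ≠ 0} (⋃ i : ℕ, {x | x.1 [i + 1] ≠ 0}) (hopen 0)
    (isOpen_iUnion fun i => hopen (i + 1))
    (by
      intro z hz
      obtain ⟨w, hw⟩ := exists_coord_ne_zero hz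
      rcases w with _ | ⟨i, t⟩
      · exact (hw z.2.nil).elim
      · have hi : z.1 [i] ≠ 0 := z.2.ne_zero_of_append (t := t) (by simp) hw
        rcases i with _ | i
        · exact Or.inl hi
        · exact Or.inr (Set.mem_iUnion.2 ⟨i, hi⟩))
    ⟨x, hroot hx, hx⟩ ⟨y, hroot hy, Set.mem_iUnion.2 ⟨0, hy⟩⟩
  obtain ⟨i, hi⟩ := Set.mem_iUnion.1 hz
  exact absurd (z.2.head_eq hz0 hi) (by omega)

theorem isDendrite : IsDendrite ShiftTree := by
  obtain ⟨x, hx⟩ := exists_coord_singleton_ne_zero 0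
  refine ⟨⟨x, root, ?_⟩, fun _ _ => exists_separating⟩
  rintro rfl
  exact hx rfl

theorem dense_isPeriodic_ne_root : Dense {x : ShiftTree | IsPeriodic shift x ∧ x ≠ root} := by
  intro x
  rw [mem_closure_iff_nhds]
  intro U hU
  obtain ⟨w, ⟨hw, hc⟩, hwU⟩ := exists_subtree_subset hU
  obtain ⟨y, hy, hyw⟩ := exists_isPeriodic_coord_ne_zero hw hc
  refine ⟨y, hwU hyw, hy, ?_⟩
  rintro rfl
  exact hyw rfl

end ShiftTree

/-- There is a dendrite with dense endpoints carrying an exact map whose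
periodic points are dense and all of them, except one fixed non-endpoint, are endpoints. -/
theorem stmt10 :
    ∃ (X : Type) (_ : MetricSpace X) (_ : CompactSpace X) (_ : ConnectedSpace X),
      IsDendrite X ∧ Dense {p : X | IsEndpointOf X p} ∧
      ∃ (F : X → X) (b : X), Continuous F ∧ ¬ IsEndpointOf X b ∧
        TopExact F ∧ F b = b ∧ Dense {p : X | IsPeriodic F p} ∧
        {p : X | IsPeriodic F p} \ {b} ⊆ {p : X | IsEndpointOf X p} := by
  have : MetrizableSpace ShiftTree := IsEmbedding.subtypeVal.metrizableSpace
  let _ : MetricSpace ShiftTree := TopologicalSpace.metrizableSpaceMetric ShiftTree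
  refine ⟨ShiftTree, inferInstance, inferInstance, inferInstance, ShiftTree.isDendrite,
    ShiftTree.dense_isPeriodic_ne_root.mono fun _ hx =>
      ShiftTree.isEndpointOf_of_isPeriodic hx.1 hx.2,
    ShiftTree.shift, ShiftTree.root, ShiftTree.continuous_shift,
    ShiftTree.not_isEndpointOf_root, ShiftTree.topExact_shift, ShiftTree.shift_root,
    ShiftTree.dense_isPeriodic_ne_root.mono fun _ hx => hx.1,
    fun _ hx => ShiftTree.isEndpointOf_of_isPeriodic hx.1 hx.2⟩
end

section
/- There exist a dendrite D and a continuous map F : D → D such that: (i) F is weakly mixing but not mixing; and (ii) F is proximal; in particular F has a unique periodic point, which is a fixed point of F. -/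
open Set Topology Filter TopologicalSpace

/-! A weighted version of spacing shifts: sequences in `[0, 1]` for which two nonzero letters may
occur at distance `d` only if the first of them lies in a finite set `gapLetters d`. The space of
these sequences is a dendrite, and the shift acts on it. -/

namespace SpacingDendrite

/-- The letters which may precede a nonzero letter at distance `d`. -/
def gapLetters (d : ℕ) : Set ℝ :=
  {r | r = 0 ∨ ∃ k m : ℕ, 8 ^ k ≤ d ∧ d < 2 * 8 ^ k ∧ m ≤ 2 ^ k ∧ r = m / 2 ^ k}

/-- The sequences in `[0, 1]` satisfying the spacing condition given by `gapLetters`. -/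
def spacingSet : Set (ℕ → ℝ) :=
  {x | (∀ i, x i ∈ Icc (0 : ℝ) 1) ∧ ∀ i d, 0 < d → x (i + d) = 0 ∨ x i ∈ gapLetters d}

lemma finite_gapLetters (d : ℕ) : (gapLetters d).Finite := by
  refine (((Set.finite_Iic d).image2 (fun k m : ℕ => (m : ℝ) / 2 ^ k)
    (Set.finite_Iic (2 ^ d))).insert 0).subset ?_
  rintro r (rfl | ⟨k, m, hk, -, hm, rfl⟩)
  · exact Set.mem_insert _ _
  · have hkd : k ≤ d := (Nat.lt_pow_self (by norm_num)).le.trans hk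
    exact Set.mem_insert_of_mem _
      ⟨k, hkd, m, hm.trans (Nat.pow_le_pow_right (by norm_num) hkd), rfl⟩

lemma not_irrational_of_mem_gapLetters {d : ℕ} {r : ℝ} (h : r ∈ gapLetters d) :
    ¬ Irrational r := by
  rcases h with rfl | ⟨k, m, -, -, -, rfl⟩
  · simp
  · intro h
    exact h ⟨m / 2 ^ k, by push_cast; rfl⟩

lemma isClosed_spacingSet : IsClosed spacingSet := by
  have : spacingSet = (⋂ i, {x : ℕ → ℝ | x i ∈ Icc (0 : ℝ) 1}) ∩
      ⋂ i, ⋂ d, ⋂ _ : 0 < d, {x : ℕ → ℝ | x (i + d) = 0} ∪ {x | x i ∈ gapLetters d} := by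
    ext x
    simp [spacingSet]
  rw [this]
  refine (isClosed_iInter fun i => isClosed_Icc.preimage (continuous_apply i)).inter
    (isClosed_iInter fun i => isClosed_iInter fun d => isClosed_iInter fun _ => ?_)
  exact (isClosed_singleton.preimage (continuous_apply (i + d))).union
    ((finite_gapLetters d).isClosed.preimage (continuous_apply i))

instance compactSpace_spacingSet : CompactSpace spacingSet := by
  refine isCompact_iff_compactSpace.mp ((isCompact_univ_pi fun _ : ℕ =>
    (isCompact_Icc : IsCompact (Icc (0 : ℝ) 1))).of_isClosed_subset isClosed_spacingSet ?_)
  exact fun x hx i _ => hx.1 i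

lemma zero_mem_spacingSet : (0 : ℕ → ℝ) ∈ spacingSet :=
  ⟨fun _ => by simp, fun _ _ _ => Or.inl rfl⟩

lemma eq_zero_of_not_mem_gap {x : ℕ → ℝ} (hx : x ∈ spacingSet) {i j : ℕ} (hij : i < j)
    (h : x i ∉ gapLetters (j - i)) : x j = 0 := by
  have := hx.2 i (j - i) (by omega)
  rw [Nat.add_sub_cancel' hij.le] at this
  exact this.resolve_right h

/-- The first `n` letters of `x`, followed by the letter `c` and zeros. -/
def cutAt (x : ℕ → ℝ) (n : ℕ) (c : ℝ) : ℕ → ℝ :=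
  fun j => if j < n then x j else if j = n then c else 0

lemma cutAt_mem {x : ℕ → ℝ} (hx : x ∈ spacingSet) {n : ℕ} {c : ℝ} (h0 : 0 ≤ c)
    (hc : c ≤ x n) : cutAt x n c ∈ spacingSet := by
  refine ⟨fun i => ?_, fun i d hd => ?_⟩
  · unfold cutAt
    split_ifs
    · exact hx.1 i
    · exact ⟨h0, hc.trans (hx.1 n).2⟩
    · simp
  · unfold cutAt
    rcases lt_trichotomy (i + d) n with h | h | h
    · simpa [h, show i < n by omega] using hx.2 i d hd
    · subst h
      rcases h0.eq_or_lt with rfl | h0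
      · simp
      · have := (hx.2 i d hd).resolve_left (h0.trans_le hc).ne'
        simp [hd, this]
    · left
      simp [show ¬ i + d < n by omega, show i + d ≠ n by omega]

lemma continuous_cutAt (x : ℕ → ℝ) (n : ℕ) : Continuous (cutAt x n) := by
  refine continuous_pi fun j => ?_
  unfold cutAt
  split_ifs <;> fun_prop

lemma cutAt_self (x : ℕ → ℝ) (n : ℕ) : cutAt x n (x n) = cutAt x (n + 1) 0 := by
  ext j
  unfold cutAt
  grind

instance connectedSpace_spacingSet : ConnectedSpace spacingSet := by
  let o : spacingSet := ⟨0, zero_mem_spacingSet⟩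
  have hcut : ∀ (x : spacingSet) (n : ℕ),
      (⟨cutAt x n 0, cutAt_mem x.2 le_rfl (x.2.1 n).1⟩ : spacingSet) ∈ connectedComponent o := by
    intro x n
    induction n with
    | zero =>
      convert mem_connectedComponent (x := o)
      simp +unfoldPartialApp [cutAt]
      rfl
    | succ n ih =>
      let g : Icc (0 : ℝ) (x.1 n) → spacingSet :=
        fun t => ⟨cutAt x n t, cutAt_mem x.2 t.2.1 t.2.2⟩
      have hg : Continuous g :=
        ((continuous_cutAt x n).comp continuous_subtype_val).subtype_mk _
      have hpre : PreconnectedSpace (Icc (0 : ℝ) (x.1 n)) :=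
        isPreconnected_iff_preconnectedSpace.mp isPreconnected_Icc
      have h0 := (x.2.1 n).1
      have hsub := (isPreconnected_range hg).subset_connectedComponent
        (x := g ⟨0, le_rfl, h0⟩) ⟨_, rfl⟩
      rw [← connectedComponent_eq ih] at hsub
      convert hsub ⟨⟨x.1 n, h0, le_rfl⟩, rfl⟩ using 2
      exact (cutAt_self _ _).symm
  have hall : connectedComponent o = univ := by
    refine eq_univ_of_forall fun x => ?_
    refine isClosed_connectedComponent.mem_of_tendsto (b := atTop) (f := fun n : ℕ =>
      (⟨cutAt x n 0, cutAt_mem x.2 le_rfl (x.2.1 n).1⟩ : spacingSet)) ?_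
      (Eventually.of_forall (hcut x))
    rw [tendsto_subtype_rng, tendsto_pi_nhds]
    refine fun i => tendsto_const_nhds.congr' ?_
    filter_upwards [eventually_gt_atTop i] with n hn
    simp [cutAt, hn]
  exact connectedSpace_iff_connectedComponent.mpr ⟨o, hall⟩

lemma exists_separating {x y : spacingSet} {n : ℕ} (hn : x.1 n < y.1 n) :
    ∃ z : spacingSet, z ≠ x ∧ z ≠ y ∧
      connectedComponentIn ({z}ᶜ : Set spacingSet) x ≠
        connectedComponentIn ({z}ᶜ : Set spacingSet) y := by
  obtain ⟨c, hirr, hxc, hcy⟩ := exists_irrational_btwn hn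
  have hc0 : 0 < c := (x.2.1 n).1.trans_lt hxc
  let z : spacingSet := ⟨cutAt y n c, cutAt_mem y.2 hc0.le hcy.le⟩
  have hzn : z.1 n = c := by simp [z, cutAt]
  refine ⟨z, fun h => ?_, fun h => ?_, fun heq => ?_⟩
  · rw [h] at hzn
    exact hxc.ne hzn
  · rw [h] at hzn
    exact hcy.ne' hzn
  have hx : x ∈ connectedComponentIn ({z}ᶜ : Set spacingSet) y := by
    refine heq ▸ mem_connectedComponentIn fun h => ?_
    rw [← mem_singleton_iff.mp h] at hzn
    exact hxc.ne hzn
  have hcont : ∀ i, Continuous fun w : spacingSet => w.1 i :=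
    fun i => (continuous_apply i).comp continuous_subtype_val
  -- The part of the dendrite beyond `z` is `A`, an open set which is closed in `{z}ᶜ`.
  let A : Set spacingSet := {w | c < w.1 n} ∩
    ⋂ i ∈ Finset.range n, {w | w.1 i ∈ (gapLetters (n - i) \ {y.1 i})ᶜ}
  let B : Set spacingSet := ({w | c ≤ w.1 n} ∩ ⋂ i ∈ Finset.range n, {w | w.1 i = y.1 i})ᶜ
  have hA : IsOpen A := (isOpen_lt continuous_const (hcont n)).inter
    (isOpen_biInter_finset fun i _ =>
      ((finite_gapLetters _).subset sdiff_subset).isClosed.isOpen_compl.preimage (hcont i))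
  have hB : IsOpen B := ((isClosed_le continuous_const (hcont n)).inter
    (isClosed_biInter fun i _ => isClosed_eq (hcont i) continuous_const)).isOpen_compl
  have hmemA : ∀ w : spacingSet, w ∈ A → c < w.1 n ∧ ∀ i < n, w.1 i = y.1 i := by
    rintro w ⟨hw, hw'⟩
    refine ⟨hw, fun i hi => ?_⟩
    simp only [mem_iInter] at hw'
    have h1 := hw' i (Finset.mem_range.mpr hi)
    by_contra hne
    refine h1 ⟨?_, hne⟩
    by_contra hgap
    exact (hc0.trans hw).ne' (eq_zero_of_not_mem_gap w.2 hi hgap)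
  have hcover : ({z}ᶜ : Set spacingSet) ⊆ A ∪ B := by
    intro w hw
    by_contra hAB
    simp only [mem_union, not_or, B, notMem_compl_iff, mem_inter_iff, mem_iInter] at hAB
    obtain ⟨hwA, hcw, hwy⟩ := hAB
    simp only [Finset.mem_range] at hwy
    have hcn : w.1 n = c := by
      by_contra hne
      refine hwA ⟨lt_of_le_of_ne hcw (Ne.symm hne), ?_⟩
      simp only [mem_iInter]
      exact fun i hi h => h.2 (hwy i (Finset.mem_range.mp hi))
    refine hw (Subtype.ext (funext fun j => ?_))
    change w.1 j = cutAt y n c j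
    unfold cutAt
    split_ifs with h1 h2
    · exact hwy j h1
    · rw [h2, hcn]
    · refine eq_zero_of_not_mem_gap w.2 (i := n) (by omega) fun h => ?_
      rw [hcn] at h
      exact not_irrational_of_mem_gapLetters h hirr
  have hyz : y ∈ ({z}ᶜ : Set spacingSet) := fun h => by
    rw [← mem_singleton_iff.mp h] at hzn
    exact hcy.ne' hzn
  have hyA : y ∈ A := by
    refine ⟨hcy, ?_⟩
    simp only [mem_iInter]
    exact fun i _ h => h.2 rfl
  obtain ⟨w, -, hwA, hwB⟩ := isPreconnected_connectedComponentIn A B hA hB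
    ((connectedComponentIn_subset _ _).trans hcover)
    ⟨y, mem_connectedComponentIn hyz, hyA⟩
    ⟨x, hx, fun h => hxc.not_ge h.1⟩
  obtain ⟨h1, h2⟩ := hmemA w hwA
  refine hwB ⟨h1.le, ?_⟩
  simp only [mem_iInter, Finset.mem_range]
  exact h2

lemma single_mem_spacingSet : (Pi.single 0 1 : ℕ → ℝ) ∈ spacingSet := by
  refine ⟨fun i => ?_, fun i d hd => Or.inl ?_⟩
  · rcases eq_or_ne i 0 with rfl | h <;> simp [*]
  · exact Pi.single_eq_of_ne (by omega) _

lemma isDendrite_spacingSet : IsDendrite spacingSet := by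
  refine ⟨⟨⟨0, zero_mem_spacingSet⟩, ⟨_, single_mem_spacingSet⟩, fun h => ?_⟩, fun x y hxy => ?_⟩
  · exact zero_ne_one (α := ℝ) (congrFun (congrArg Subtype.val h) 0)
  obtain ⟨n, hn⟩ := Function.ne_iff.mp (Subtype.coe_ne_coe.mpr hxy)
  rcases hn.lt_or_gt with h | h
  · exact exists_separating h
  · obtain ⟨z, hzy, hzx, hne⟩ := exists_separating h
    exact ⟨z, hzx, hzy, hne.symm⟩

/-- The shift on `spacingSet`. -/
def shift (x : spacingSet) : spacingSet :=
  ⟨fun i => x.1 (i + 1), fun i => x.2.1 (i + 1), fun i d hd => by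
    simpa [add_right_comm] using x.2.2 (i + 1) d hd⟩

lemma shift_iterate_apply (n : ℕ) (x : spacingSet) (i : ℕ) :
    (shift^[n] x).1 i = x.1 (i + n) := by
  induction n generalizing x with
  | zero => rfl
  | succ n ih =>
    rw [Function.iterate_succ_apply, ih]
    rfl

lemma continuous_shift : Continuous shift :=
  Continuous.subtype_mk (f := fun (x : spacingSet) i => x.1 (i + 1))
    (continuous_pi fun i => (continuous_apply (i + 1)).comp continuous_subtype_val) _

/-- The first `k` letters of `x` rounded down to multiples of `2⁻ᵏ`, followed by the first `k`
letters of `y`, starting at position `8 ^ k + k`. -/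
noncomputable def splice (k : ℕ) (x y : ℕ → ℝ) : ℕ → ℝ := fun i =>
  if i < k then ⌊x i * 2 ^ k⌋₊ / 2 ^ k
  else if 8 ^ k + k ≤ i ∧ i < 8 ^ k + k + k then y (i - (8 ^ k + k)) else 0

lemma floor_div_eq_self {d k : ℕ} {r : ℝ} (hr : r ∈ gapLetters d) (hd : d ≤ k) :
    (⌊r * 2 ^ k⌋₊ : ℝ) / 2 ^ k = r := by
  rcases hr with rfl | ⟨l, m, hl, -, -, rfl⟩
  · simp
  · have hlk : l ≤ k := ((Nat.lt_pow_self (by norm_num)).le.trans hl).trans hd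
    have : (m : ℝ) / 2 ^ l * 2 ^ k = (m * 2 ^ (k - l) : ℕ) := by
      rw [← Nat.sub_add_cancel hlk, pow_add]
      push_cast
      field_simp
      simp
    rw [this, Nat.floor_natCast, ← this]
    field_simp

lemma floor_mul_le {k : ℕ} {r : ℝ} (hr : r ≤ 1) : ⌊r * 2 ^ k⌋₊ ≤ 2 ^ k := by
  refine Nat.floor_le_of_le ?_
  push_cast
  exact mul_le_of_le_one_left (by positivity) hr

lemma splice_mem (k : ℕ) {x y : ℕ → ℝ} (hx : x ∈ spacingSet) (hy : y ∈ spacingSet) :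
    splice k x y ∈ spacingSet := by
  have hk : 2 * k < 8 ^ k := by
    have h1 : k < 2 ^ k := Nat.lt_pow_self (by norm_num)
    rcases k.eq_zero_or_pos with rfl | hpos
    · norm_num
    · have h2 : 8 ^ k = 2 ^ k * 4 ^ k := by
        rw [← mul_pow]
        norm_num
      have h3 : 4 ^ 1 ≤ 4 ^ k := Nat.pow_le_pow_right (by norm_num) hpos
      nlinarith
  refine ⟨fun i => ?_, fun i d hd => ?_⟩
  · unfold splice
    split_ifs
    · refine ⟨by positivity, div_le_one_of_le₀ ?_ (by positivity)⟩
      exact_mod_cast floor_mul_le (hx.1 i).2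
    · exact hy.1 _
    · simp
  · by_cases hend : i + d < k
    · have hi : i < k := by omega
      simp only [splice, hend, hi, if_true]
      rcases hx.2 i d hd with h | h
      · left
        simp [h]
      · right
        rwa [floor_div_eq_self h (by omega)]
    by_cases hy' : 8 ^ k + k ≤ i + d ∧ i + d < 8 ^ k + k + k
    · by_cases hi : i < k
      · right
        simp only [splice, hi, if_true]
        exact Or.inr ⟨k, _, by omega, by omega, floor_mul_le (hx.1 i).2, rfl⟩
      · by_cases hi' : 8 ^ k + k ≤ i ∧ i < 8 ^ k + k + k
        · have := hy.2 (i - (8 ^ k + k)) d hd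
          rw [← Nat.sub_add_comm hi'.1] at this
          simpa only [splice, hend, hi, hi', hy', if_true, if_false, and_self] using this
        · right
          simp [splice, hi, hi', gapLetters]
    · left
      simp [splice, hend, hy']

lemma tendsto_floor_div (r : ℝ) (hr : 0 ≤ r) :
    Tendsto (fun k : ℕ => (⌊r * 2 ^ k⌋₊ : ℝ) / 2 ^ k) atTop (𝓝 r) :=
  (tendsto_nat_floor_mul_div_atTop hr).comp (tendsto_pow_atTop_atTop_of_one_lt one_lt_two)

lemma tendsto_splice (x y : spacingSet) :
    Tendsto (fun k => (⟨splice k x y, splice_mem k x.2 y.2⟩ : spacingSet)) atTop (𝓝 x) := by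
  rw [tendsto_subtype_rng, tendsto_pi_nhds]
  refine fun i => (tendsto_floor_div (x.1 i) (x.2.1 i).1).congr' ?_
  filter_upwards [eventually_gt_atTop i] with k hk
  simp [splice, hk]

lemma tendsto_shift_iterate_splice (x y : spacingSet) :
    Tendsto (fun k => shift^[8 ^ k + k] ⟨splice k x y, splice_mem k x.2 y.2⟩) atTop (𝓝 y) := by
  rw [tendsto_subtype_rng, tendsto_pi_nhds]
  refine fun i => tendsto_const_nhds.congr' ?_
  filter_upwards [eventually_gt_atTop i] with k hk
  have h8 : 0 < 8 ^ k := by positivity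
  rw [shift_iterate_apply]
  simp only [splice]
  rw [if_neg (by omega), if_pos (by omega), Nat.add_sub_cancel]

lemma weaklyMixing_shift : WeaklyMixing shift := by
  rintro U V hU hV ⟨⟨x, x'⟩, hx⟩ ⟨⟨y, y'⟩, hy⟩
  have h1 := ((tendsto_splice x y).prodMk_nhds (tendsto_splice x' y')).eventually
    (hU.mem_nhds hx)
  have h2 := ((tendsto_shift_iterate_splice x y).prodMk_nhds
    (tendsto_shift_iterate_splice x' y')).eventually (hV.mem_nhds hy)
  obtain ⟨k, hkU, hkV⟩ := (h1.and h2).exists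
  refine ⟨8 ^ k + k, by positivity, _, ⟨_, hkU, rfl⟩, ?_⟩
  rw [Prod.map_iterate]
  exact hkV

lemma not_topMixing_shift : ¬ TopMixing shift := by
  intro h
  have hopen : IsOpen {x : spacingSet | 0 < x.1 0} :=
    isOpen_lt continuous_const ((continuous_apply 0).comp continuous_subtype_val)
  have hne : {x : spacingSet | 0 < x.1 0}.Nonempty := ⟨⟨_, single_mem_spacingSet⟩, by simp⟩
  obtain ⟨N, hN⟩ := h _ _ hopen hopen hne hne
  have hlt : N < 8 ^ N := Nat.lt_pow_self (by norm_num)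
  obtain ⟨_, ⟨x, hx, rfl⟩, hx'⟩ := hN (2 * 8 ^ N) (by omega)
  simp only [mem_ofPred_eq, shift_iterate_apply] at hx hx'
  rcases x.2.2 0 (2 * 8 ^ N) (by positivity) with h | h | ⟨k, m, h1, h2, -⟩
  · exact hx'.ne' h
  · exact hx.ne' h
  · have hNk : N < k := by
      rw [← Nat.pow_lt_pow_iff_right (a := 8) (by norm_num)]
      omega
    have : 8 ^ (N + 1) ≤ 8 ^ k := Nat.pow_le_pow_right (by norm_num) hNk
    rw [pow_succ] at this
    omega

lemma not_both_ne_zero (x : spacingSet) {k i d : ℕ} (h1 : 2 * 8 ^ k ≤ d) (h2 : d < 8 ^ (k + 1)) :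
    x.1 i = 0 ∨ x.1 (i + d) = 0 := by
  have h8 : 0 < 8 ^ k := by positivity
  rcases x.2.2 i d (by omega) with h | h | ⟨l, m, h3, h4, -⟩
  · exact Or.inr h
  · exact Or.inl h
  · have hkl : k < l := by
      rw [← Nat.pow_lt_pow_iff_right (a := 8) (by norm_num)]
      omega
    have hlk : l < k + 1 := by
      rw [← Nat.pow_lt_pow_iff_right (a := 8) (by norm_num)]
      omega
    omega

/-- Of three blocks of length `8 ^ k` with gaps of length `2 * 8 ^ k`, any sequence vanishes on at
least two. -/
lemma vanish_on_block (x : spacingSet) (a k : ℕ) {s t : ℕ} (hst : s < t) (ht : t < 3) :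
    (∀ i < 8 ^ k, x.1 (i + (a + 3 * s * 8 ^ k)) = 0) ∨
      ∀ i < 8 ^ k, x.1 (i + (a + 3 * t * 8 ^ k)) = 0 := by
  by_contra! h
  obtain ⟨⟨i, hi, hxi⟩, j, hj, hxj⟩ := h
  have hts : (s = 0 ∧ t = 1) ∨ (s = 0 ∧ t = 2) ∨ (s = 1 ∧ t = 2) := by omega
  have hle : i + (a + 3 * s * 8 ^ k) ≤ j + (a + 3 * t * 8 ^ k) := by
    rcases hts with ⟨rfl, rfl⟩ | ⟨rfl, rfl⟩ | ⟨rfl, rfl⟩ <;> omega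
  have key := not_both_ne_zero x (k := k) (i := i + (a + 3 * s * 8 ^ k))
    (d := j + (a + 3 * t * 8 ^ k) - (i + (a + 3 * s * 8 ^ k)))
    (by rcases hts with ⟨rfl, rfl⟩ | ⟨rfl, rfl⟩ | ⟨rfl, rfl⟩ <;> omega)
    (by rw [pow_succ]; rcases hts with ⟨rfl, rfl⟩ | ⟨rfl, rfl⟩ | ⟨rfl, rfl⟩ <;> omega)
  rw [Nat.add_sub_cancel' hle] at key
  exact key.elim hxi hxj

lemma exists_common_zero_block (x y : spacingSet) (k : ℕ) :
    ∃ n, k ≤ n ∧ ∀ i < k, x.1 (i + n) = 0 ∧ y.1 (i + n) = 0 := by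
  have hk : k < 8 ^ k := Nat.lt_pow_self (by norm_num)
  suffices ∃ s, (∀ i < 8 ^ k, x.1 (i + (k + 3 * s * 8 ^ k)) = 0) ∧
      ∀ i < 8 ^ k, y.1 (i + (k + 3 * s * 8 ^ k)) = 0 by
    obtain ⟨s, h1, h2⟩ := this
    exact ⟨_, Nat.le_add_right _ _, fun i hi => ⟨h1 i (by omega), h2 i (by omega)⟩⟩
  have pigeonhole : ∀ P Q : ℕ → Prop, (∀ s t, s < t → t < 3 → P s ∨ P t) →
      (∀ s t, s < t → t < 3 → Q s ∨ Q t) → ∃ s, P s ∧ Q s := by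
    intro P Q hP hQ
    by_contra! h
    have hP' := And.intro (hP 0 1) (And.intro (hP 0 2) (hP 1 2))
    have hQ' := And.intro (hQ 0 1) (And.intro (hQ 0 2) (hQ 1 2))
    have h' := And.intro (h 0) (And.intro (h 1) (h 2))
    norm_num at hP' hQ'
    tauto
  exact pigeonhole _ _ (fun _ _ => vanish_on_block x k k) (fun _ _ => vanish_on_block y k k)

lemma exists_common_tendsto_zero (x y : spacingSet) :
    ∃ n : ℕ → ℕ, Tendsto n atTop atTop ∧
      Tendsto (fun k => shift^[n k] x) atTop (𝓝 ⟨0, zero_mem_spacingSet⟩) ∧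
      Tendsto (fun k => shift^[n k] y) atTop (𝓝 ⟨0, zero_mem_spacingSet⟩) := by
  choose n hn hxy using exists_common_zero_block x y
  refine ⟨n, tendsto_atTop_mono hn tendsto_id, ?_, ?_⟩ <;>
  · rw [tendsto_subtype_rng, tendsto_pi_nhds]
    refine fun i => tendsto_const_nhds.congr' ?_
    filter_upwards [eventually_gt_atTop i] with k hk
    simp [shift_iterate_apply, hxy k i hk]

lemma shift_zero : shift ⟨0, zero_mem_spacingSet⟩ = ⟨0, zero_mem_spacingSet⟩ := rfl

lemma eq_zero_of_isPeriodic {q : spacingSet} (hq : IsPeriodic shift q) :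
    q = ⟨0, zero_mem_spacingSet⟩ := by
  obtain ⟨m, hm, hqm⟩ := hq
  have hper : ∀ i t, q.1 (i + m * t) = q.1 i := by
    intro i t
    rw [← shift_iterate_apply, Function.iterate_mul, Function.iterate_fixed hqm]
  obtain ⟨n, -, hn⟩ := exists_common_zero_block q q m
  refine Subtype.ext (funext fun j => ?_)
  have h1 := (hn ((j + m * n - n) % m) (Nat.mod_lt _ hm)).1
  have h2 : (j + m * n - n) % m + n + m * ((j + m * n - n) / m) = j + m * n := by
    have := Nat.mod_add_div (j + m * n - n) m
    have : n ≤ m * n := Nat.le_mul_of_pos_left n hm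
    omega
  rw [← hper _ ((j + m * n - n) / m), h2, hper] at h1
  exact h1

end SpacingDendrite

lemma liminf_dist_eq_zero_of_tendsto {X : Type*} [PseudoMetricSpace X] [CompactSpace X]
    {u v : ℕ → X} {p : X} {n : ℕ → ℕ} (hn : Tendsto n atTop atTop)
    (hu : Tendsto (u ∘ n) atTop (𝓝 p)) (hv : Tendsto (v ∘ n) atTop (𝓝 p)) :
    liminf (fun i => dist (u i) (v i)) atTop = 0 := by
  have hd : Tendsto (fun k => dist (u (n k)) (v (n k))) atTop (𝓝 0) := by
    simpa using hu.dist hv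
  have hbdd : IsBoundedUnder (· ≥ ·) atTop fun i => dist (u i) (v i) :=
    isBoundedUnder_of ⟨0, fun _ => dist_nonneg⟩
  have hcobdd : IsCoboundedUnder (· ≥ ·) atTop fun i => dist (u i) (v i) :=
    IsBoundedUnder.isCoboundedUnder_ge (isBoundedUnder_of
      ⟨Metric.diam (univ : Set X), fun _ => Metric.dist_le_diam_of_mem
        isCompact_univ.isBounded (mem_univ _) (mem_univ _)⟩)
  refine le_antisymm (le_of_forall_pos_le_add fun ε hε => ?_)
    (le_liminf_of_le hcobdd (Eventually.of_forall fun _ => dist_nonneg))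
  rw [zero_add]
  exact liminf_le_of_frequently_le
    (hn.frequently ((hd.eventually_le_const hε).frequently)) hbdd

/-- There is a dendrite carrying a weakly mixing, non-mixing, proximal map;
in particular it has a unique periodic point, which is a fixed point. -/
theorem stmt11 :
    ∃ (D : Type) (_ : MetricSpace D) (_ : CompactSpace D) (_ : ConnectedSpace D),
      IsDendrite D ∧
      ∃ F : D → D, Continuous F ∧ WeaklyMixing F ∧ ¬ TopMixing F ∧
        (∀ x y : D, Filter.liminf (fun n : ℕ => dist (F^[n] x) (F^[n] y))
          Filter.atTop = 0) ∧
        ∃ p : D, F p = p ∧ ∀ q : D, IsPeriodic F q → q = p := by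
  let _ : MetricSpace SpacingDendrite.spacingSet := metrizableSpaceMetric _
  refine ⟨SpacingDendrite.spacingSet, inferInstance, inferInstance, inferInstance,
    SpacingDendrite.isDendrite_spacingSet, SpacingDendrite.shift,
    SpacingDendrite.continuous_shift, SpacingDendrite.weaklyMixing_shift,
    SpacingDendrite.not_topMixing_shift, fun x y => ?_, _, SpacingDendrite.shift_zero,
    fun _ => SpacingDendrite.eq_zero_of_isPeriodic⟩
  obtain ⟨n, hn, hx, hy⟩ := SpacingDendrite.exists_common_tendsto_zero x y
  exact liminf_dist_eq_zero_of_tendsto (u := fun n => SpacingDendrite.shift^[n] x)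
    (v := fun n => SpacingDendrite.shift^[n] y) hn hx hy
end
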